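/- Suppose α, β ∈ (0,π), μ : ℕ → ℝ is a strictly increasing sequence enumerating precisely the eigenvalues of L(q,α,β), and Φ(λ) = φ(π,λ)·cos β + φ'(π,λ)·sin β is the characteristic function, where φ(·,λ) is the solution with φ(0,λ) = sin α, φ'(0,λ) = −cos α. Then the infinite product ∏_{k=1}^∞ (μ_k − μ₀)/k² converges and the derivative of Φ at μ₀ equals Φ̇(μ₀) = −π·sin α·sin β·∏_{k=1}^∞ (μ_k − μ₀)/k². -/

import Mathlib

open Real MeasureTheory Set

noncomputable section

/-- `y` (with derivative `y'`) solves `-y'' + Q y = μ y` on `[0, π]`: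
`y` is differentiable with derivative `y'`, and
`y' x = y' 0 + ∫ t in 0..x, (Q t - μ) * y t` for all `x ∈ [0, π]`. -/
def IsSol (Q : ℝ → ℝ) (μ : ℝ) (y y' : ℝ → ℝ) : Prop :=
  (∀ x ∈ Set.Icc (0 : ℝ) π, HasDerivAt y (y' x) x) ∧
  (∀ x ∈ Set.Icc (0 : ℝ) π, y' x = y' 0 + ∫ t in (0 : ℝ)..x, (Q t - μ) * y t)

/-- `μ` is an eigenvalue of the Sturm–Liouville problem `L(Q, γ, δ)`. -/
def IsEigenvalue (Q : ℝ → ℝ) (γ δ : ℝ) (μ : ℝ) : Prop :=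
  ∃ y y' : ℝ → ℝ, IsSol Q μ y y' ∧
    (∃ x ∈ Set.Icc (0 : ℝ) π, y x ≠ 0) ∧
    y 0 * Real.cos γ + y' 0 * Real.sin γ = 0 ∧
    y π * Real.cos δ + y' π * Real.sin δ = 0


lemma ibp_real (g h h' : ℝ → ℝ) (x : ℝ) (hg : IntervalIntegrable g volume 0 x)
    (hh : ∀ t, HasDerivAt h (h' t) t) (hc : Continuous h') :
    ∫ t in (0:ℝ)..x, h t * g t = h x * (∫ t in (0:ℝ)..x, g t)
      - ∫ t in (0:ℝ)..x, h' t * ∫ r in (0:ℝ)..t, g r := by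
  have hG := hg.absolutelyContinuousOnInterval_intervalIntegral (c := 0) (by simp)
  have hd : deriv h = h' := funext fun t => (hh t).deriv
  have hcd : ContDiff ℝ 1 h := by
    rw [contDiff_one_iff_deriv]
    exact ⟨fun t => (hh t).differentiableAt, hd ▸ hc⟩
  have hH : AbsolutelyContinuousOnInterval h 0 x := hcd.contDiffOn.absolutelyContinuousOnInterval
  have := hH.integral_mul_deriv_eq_deriv_mul hG
  simp only [intervalIntegral.integral_same, mul_zero, sub_zero, hd] at this
  rw [← this]
  apply intervalIntegral.integral_congr_ae
  filter_upwards [hg.ae_hasDerivAt_integral] with t ht hx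
  rw [(ht (uIoc_subset_uIcc hx) 0 (by simp)).deriv]

lemma ii_re (f : ℝ → ℂ) (x : ℝ) (hf : IntervalIntegrable f volume 0 x) :
    (∫ t in (0:ℝ)..x, f t).re = ∫ t in (0:ℝ)..x, (f t).re := by
  have := Complex.reCLM.intervalIntegral_comp_comm hf
  simpa using this.symm

lemma ii_im (f : ℝ → ℂ) (x : ℝ) (hf : IntervalIntegrable f volume 0 x) :
    (∫ t in (0:ℝ)..x, f t).im = ∫ t in (0:ℝ)..x, (f t).im := by
  have := Complex.imCLM.intervalIntegral_comp_comm hf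
  simpa using this.symm

lemma ii_prim_cont {E : Type*} [NormedAddCommGroup E] [NormedSpace ℝ E] (g : ℝ → E) (x : ℝ)
    (hg : IntervalIntegrable g volume 0 x) :
    ContinuousOn (fun t => ∫ r in (0:ℝ)..t, g r) (uIcc 0 x) := by
  apply intervalIntegral.continuousOn_primitive_interval' hg (by simp)

lemma ii_sub {E : Type*} [NormedAddCommGroup E] [NormedSpace ℝ E] {g : ℝ → E} {x t : ℝ}
    (hg : IntervalIntegrable g volume 0 x) (ht : t ∈ uIcc 0 x) :
    IntervalIntegrable g volume 0 t := 
  hg.mono_set (uIcc_subset_uIcc (by simp) ht)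

/-- complex ibp -/
lemma ibp (g h h' : ℝ → ℂ) (x : ℝ) (hg : IntervalIntegrable g volume 0 x)
    (hh : ∀ t, HasDerivAt h (h' t) t) (hc : Continuous h') :
    ∫ t in (0:ℝ)..x, h t * g t = h x * (∫ t in (0:ℝ)..x, g t)
      - ∫ t in (0:ℝ)..x, h' t * ∫ r in (0:ℝ)..t, g r := by
  have hhc : Continuous h := continuous_iff_continuousAt.2 fun t => (hh t).continuousAt
  have gr : IntervalIntegrable (fun t => (g t).re) volume 0 x := 
    ⟨hg.1.re, hg.2.re⟩
  have gi : IntervalIntegrable (fun t => (g t).im) volume 0 x := 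
    ⟨hg.1.im, hg.2.im⟩
  have hr : ∀ t, HasDerivAt (fun t => (h t).re) (h' t).re t := fun t => by
    simpa using! Complex.reCLM.hasFDerivAt.comp_hasDerivAt t (hh t)
  have hi : ∀ t, HasDerivAt (fun t => (h t).im) (h' t).im t := fun t => by
    simpa using! Complex.imCLM.hasFDerivAt.comp_hasDerivAt t (hh t)
  have cr : Continuous fun t => (h' t).re := Complex.continuous_re.comp hc
  have ci : Continuous fun t => (h' t).im := Complex.continuous_im.comp hc
  have i1 : IntervalIntegrable (fun t => h t * g t) volume 0 x :=
    hg.continuousOn_mul hhc.continuousOn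
  have i2 : IntervalIntegrable (fun t => h' t * ∫ r in (0:ℝ)..t, g r) volume 0 x :=
    (hc.continuousOn.mul (ii_prim_cont g x hg)).intervalIntegrable
  have e1 := ibp_real _ _ _ x gr hr cr
  have e2 := ibp_real _ _ _ x gr hi ci
  have e3 := ibp_real _ _ _ x gi hr cr
  have e4 := ibp_real _ _ _ x gi hi ci
  have pr : ∀ t ∈ uIcc 0 x, (h' t * ∫ r in (0:ℝ)..t, g r).re = 
     (h' t).re * (∫ r in (0:ℝ)..t, (g r).re) - (h' t).im * (∫ r in (0:ℝ)..t, (g r).im) := by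
    intro t ht
    rw [Complex.mul_re, ii_re _ _ (ii_sub hg ht), ii_im _ _ (ii_sub hg ht)]
  have pi : ∀ t ∈ uIcc 0 x, (h' t * ∫ r in (0:ℝ)..t, g r).im = 
     (h' t).re * (∫ r in (0:ℝ)..t, (g r).im) + (h' t).im * (∫ r in (0:ℝ)..t, (g r).re) := by
    intro t ht
    rw [Complex.mul_im, ii_re _ _ (ii_sub hg ht), ii_im _ _ (ii_sub hg ht)]
  have c1 := ii_prim_cont _ x gr
  have c2 := ii_prim_cont _ x gi
  apply Complex.ext
  · rw [ii_re _ _ i1, Complex.sub_re, Complex.mul_re, ii_re _ _ i2, ii_re _ _ hg, ii_im _ _ hg,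
      intervalIntegral.integral_congr pr, intervalIntegral.integral_sub, ]
    · simp only [Complex.mul_re]
      rw [intervalIntegral.integral_sub, e1, e4]
      · ring
      · exact gr.continuousOn_mul (Complex.continuous_re.comp hhc).continuousOn
      · exact gi.continuousOn_mul (Complex.continuous_im.comp hhc).continuousOn
    · exact (cr.continuousOn.mul c1).intervalIntegrable
    · exact (ci.continuousOn.mul c2).intervalIntegrable
  · rw [ii_im _ _ i1, Complex.sub_im, Complex.mul_im, ii_im _ _ i2, ii_re _ _ hg, ii_im _ _ hg,
      intervalIntegral.integral_congr pi, intervalIntegral.integral_add, ]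
    · simp only [Complex.mul_im]
      rw [intervalIntegral.integral_add, e2, e3]
      · ring
      · exact gi.continuousOn_mul (Complex.continuous_re.comp hhc).continuousOn
      · exact gr.continuousOn_mul (Complex.continuous_im.comp hhc).continuousOn
    · exact (cr.continuousOn.mul c2).intervalIntegrable
    · exact (ci.continuousOn.mul c1).intervalIntegrable



lemma gen_diff {E : Type*} [NormedAddCommGroup E] [NormedSpace ℂ E] [CompleteSpace E]
    (A B : E →L[ℂ] E) (hu : ∀ lam : ℂ, IsUnit (1 - (A - lam • B))) (e : E) :
    Differentiable ℂ (fun lam : ℂ => Ring.inverse (1 - (A - lam • B)) e) := by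
  intro lam
  have h1 := (differentiableAt_inverse (𝕜 := ℂ) (R := E →L[ℂ] E) (hu lam))
  have h3 : DifferentiableAt ℂ (fun lam : ℂ => (1 - (A - lam • B))) lam := by
    fun_prop
  have d1 := DifferentiableAt.comp (g := Ring.inverse) lam h1 h3
  exact d1.clm_apply (differentiableAt_const _)

lemma gen_unit {E : Type*} [NormedAddCommGroup E] [NormedSpace ℂ E] [CompleteSpace E]
    (T S K : E →L[ℂ] E) (m1 : T * S = 1) (m2 : S * T = 1) (hn : ‖S * K * T‖ ≤ 1 / 2) :
    IsUnit (1 - K) := by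
  have hu : IsUnit (1 - S * K * T) := 
    isUnit_one_sub_of_norm_lt_one (lt_of_le_of_lt hn (by norm_num))
  have e : 1 - K = T * (1 - S * K * T) * S := by
    simp only [mul_sub, sub_mul, mul_one, m1]
    simp only [← mul_assoc, m1, one_mul]
    rw [mul_assoc, m1, mul_one]
  rw [e]
  exact ((Units.mk T S m1 m2).isUnit.mul hu).mul (Units.mk S T m2 m1).isUnit

abbrev EE := C(Icc (0:ℝ) π, ℂ)

def ex (f : EE) : ℝ → ℂ := IccExtend pi_pos.le f

lemma ex_cont (f : EE) : Continuous (ex f) := f.continuous.Icc_extend'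

lemma ex_apply (f : EE) {x : ℝ} (hx : x ∈ Icc (0:ℝ) π) : ex f x = f ⟨x, hx⟩ :=
  IccExtend_of_mem _ _ hx

lemma ex_norm (f : EE) (x : ℝ) : ‖ex f x‖ ≤ ‖f‖ := f.norm_coe_le_norm _

lemma sub_pi {x : ℝ} (hx : x ∈ Icc (0:ℝ) π) : x ∈ uIcc 0 π := by
  rwa [uIcc_of_le pi_pos.le]

lemma mulE (p : ℝ → ℂ) (hp : IntervalIntegrable p volume 0 π) (f : EE) :
    IntervalIntegrable (fun t => p t * ex f t) volume 0 π :=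
  hp.mul_continuousOn (ex_cont f).continuousOn

def KF (p : ℝ → ℂ) (f : EE) (x : ℝ) : ℂ :=
  ∫ t in (0:ℝ)..x, ((x - t : ℝ) : ℂ) * (p t * ex f t)

lemma KF_cont (p : ℝ → ℂ) (hp : IntervalIntegrable p volume 0 π) (f : EE) :
    ContinuousOn (KF p f) (Icc 0 π) := by
  have h1 := mulE p hp f
  have h2 : IntervalIntegrable (fun t => (t : ℂ) * (p t * ex f t)) volume 0 π :=
    h1.continuousOn_mul (Complex.continuous_ofReal).continuousOn
  have c1 := ii_prim_cont _ _ h1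
  have c2 := ii_prim_cont _ _ h2
  rw [uIcc_of_le pi_pos.le] at c1 c2
  have : ContinuousOn (fun x : ℝ => (x:ℂ) * (∫ t in (0:ℝ)..x, (p t * ex f t)) - 
      ∫ t in (0:ℝ)..x, (t : ℂ) * (p t * ex f t)) (Icc 0 π) :=
    ((Complex.continuous_ofReal).continuousOn.mul c1).sub c2
  refine this.congr fun x hx => ?_
  simp only [KF]
  rw [← intervalIntegral.integral_const_mul, ← intervalIntegral.integral_sub]
  · congr 1; ext t; push_cast; ring
  · exact (ii_sub h1 (sub_pi hx)).const_mul _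
  · exact ii_sub h2 (sub_pi hx)

lemma KF_int (p : ℝ → ℂ) (hp : IntervalIntegrable p volume 0 π) (f : EE) (x : ℝ)
    (hx : x ∈ Icc (0:ℝ) π) : 
    IntervalIntegrable (fun t => ((x - t : ℝ) : ℂ) * (p t * ex f t)) volume 0 x := by
  apply (ii_sub (mulE p hp f) (sub_pi hx)).continuousOn_mul
  exact (Complex.continuous_ofReal.comp (by fun_prop)).continuousOn

lemma KF_bound (p : ℝ → ℂ) (hp : IntervalIntegrable p volume 0 π) (k : ℝ → ℂ)
    (C : ℝ) (f : EE) (x : ℝ) (hx : x ∈ Icc (0:ℝ) π) (hC : ∀ t ∈ Icc 0 x, ‖k t‖ ≤ C) :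
    ‖∫ t in (0:ℝ)..x, k t * (p t * ex f t)‖ ≤ C * (∫ t in (0:ℝ)..π, ‖p t‖) * ‖f‖ := by
  have C0 : 0 ≤ C := (norm_nonneg _).trans (hC 0 ⟨le_rfl, hx.1⟩)
  have hpx := ii_sub hp (sub_pi hx)
  calc ‖∫ t in (0:ℝ)..x, k t * (p t * ex f t)‖ 
      ≤ ∫ t in (0:ℝ)..x, (C * ‖f‖) * ‖p t‖ := by
        apply intervalIntegral.norm_integral_le_of_norm_le hx.1
        · refine Filter.Eventually.of_forall fun t ht => ?_
          rw [norm_mul, norm_mul]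
          have h1 := hC t ⟨ht.1.le, ht.2⟩
          have h2 := ex_norm f t
          calc ‖k t‖ * (‖p t‖ * ‖ex f t‖) ≤ C * (‖p t‖ * ‖f‖) := by gcongr
            _ = _ := by ring
        · exact hpx.norm.const_mul _
    _ = (C * ‖f‖) * ∫ t in (0:ℝ)..x, ‖p t‖ := by rw [intervalIntegral.integral_const_mul]
    _ ≤ (C * ‖f‖) * ∫ t in (0:ℝ)..π, ‖p t‖ := by
        gcongr
        apply intervalIntegral.integral_mono_interval le_rfl hx.1 hx.2
        · exact Filter.Eventually.of_forall fun t => norm_nonneg _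
        · exact hp.norm
    _ = _ := by ring

def Kop (p : ℝ → ℂ) (hp : IntervalIntegrable p volume 0 π) : EE →L[ℂ] EE :=
  LinearMap.mkContinuous
    { toFun := fun f => ⟨fun x => KF p f x, (KF_cont p hp f).domRestrict⟩
      map_add' := by
        intro f g
        ext x
        simp only [ContinuousMap.coe_mk, ContinuousMap.add_apply, KF]
        rw [← intervalIntegral.integral_add (KF_int p hp f x x.2) (KF_int p hp g x x.2)]
        congr 1; ext t; simp [ex, IccExtend]; ring
      map_smul' := by
        intro c f
        ext x
        simp only [ContinuousMap.coe_mk, ContinuousMap.smul_apply, KF, RingHom.id_apply, smul_eq_mul]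
        rw [← intervalIntegral.integral_const_mul]
        congr 1; ext t; simp [ex, IccExtend]; ring }
    (π * (∫ t in (0:ℝ)..π, ‖p t‖)) (by
      intro f
      rw [ContinuousMap.norm_le]
      · intro x
        apply KF_bound p hp _ π f x x.2
        · intro t ht
          rw [Complex.norm_real, Real.norm_eq_abs, abs_le]
          constructor <;> linarith [ht.1, ht.2, x.2.2, pi_pos]
      · have : 0 ≤ ∫ t in (0:ℝ)..π, ‖p t‖ := 
          intervalIntegral.integral_nonneg pi_pos.le fun t _ => norm_nonneg _
        have := pi_pos
        positivity)

lemma Kop_apply (p : ℝ → ℂ) (hp : IntervalIntegrable p volume 0 π) (f : EE) (x : Icc (0:ℝ) π) :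
    Kop p hp f x = KF p f x := rfl

def wE (M : ℝ) : EE := ⟨fun x => (Real.exp (M * x) : ℝ), by fun_prop⟩

def TT (M : ℝ) : EE →L[ℂ] EE := ContinuousLinearMap.mul ℂ EE (wE M)

lemma TT_apply (M : ℝ) (f : EE) (x : Icc (0:ℝ) π) : TT M f x = (Real.exp (M * x) : ℝ) * f x := rfl

lemma TT_mul (M : ℝ) : TT M * TT (-M) = 1 := by
  ext f x
  simp only [mul_apply_eq_comp, TT_apply, one_apply_eq_self]
  rw [← mul_assoc, ← Complex.ofReal_mul, ← Real.exp_add]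
  simp

lemma unit_one_sub (p : ℝ → ℂ) (hp : IntervalIntegrable p volume 0 π) :
    IsUnit (1 - Kop p hp) := by
  set P := ∫ t in (0:ℝ)..π, ‖p t‖ with hP
  have P0 : 0 ≤ P := intervalIntegral.integral_nonneg pi_pos.le fun t _ => norm_nonneg _
  set M := 2 * (P + 1) with hM
  have M0 : 0 < M := by positivity
  have m1 : TT M * TT (-M) = 1 := TT_mul M
  have m2 : TT (-M) * TT M = 1 := by simpa using TT_mul (-M)
  have hn : ‖TT (-M) * Kop p hp * TT M‖ ≤ 1 / 2 := by
    apply ContinuousLinearMap.opNorm_le_bound _ (by norm_num)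
    intro f
    rw [ContinuousMap.norm_le _ (by positivity)]
    intro x
    simp only [mul_apply_eq_comp, TT_apply, Kop_apply, KF]
    have : ∀ t ∈ uIcc 0 (x:ℝ), ((x - t : ℝ) : ℂ) * (p t * ex (TT M f) t) = 
       (((x - t : ℝ) : ℂ) * (Real.exp (M * t) : ℝ)) * (p t * ex f t) := by
      intro t ht
      have ht' : t ∈ Icc 0 π := by
        rw [uIcc_of_le x.2.1] at ht
        exact ⟨ht.1, ht.2.trans x.2.2⟩
      rw [ex_apply _ ht', ex_apply _ ht', TT_apply]
      ring
    rw [intervalIntegral.integral_congr this, ← intervalIntegral.integral_const_mul]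
    simp only [← mul_assoc]
    have hb := KF_bound p hp (fun t => (Real.exp (-M * x) : ℝ) * ((x - t : ℝ) : ℂ) * (Real.exp (M * t) : ℝ))
      (1 / M) f x x.2 (by
        intro t ht
        rw [← Complex.ofReal_mul, ← Complex.ofReal_mul, Complex.norm_real, Real.norm_of_nonneg]
        · have : Real.exp (-M * x) * (x - t) * Real.exp (M * t) = (x - t) / Real.exp (M * (x - t)) := by
            rw [div_eq_mul_inv, ← Real.exp_neg, mul_right_comm, ← Real.exp_add, mul_comm]
            congr 2; ring
          rw [this, div_le_div_iff₀ (Real.exp_pos _) M0]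
          linarith [Real.add_one_le_exp (M * (x - t))]
        · have := sub_nonneg.2 ht.2
          positivity)
    simp only [← mul_assoc] at hb
    refine hb.trans ?_
    gcongr
    rw [one_div, inv_mul_le_iff₀ M0]
    linarith
  exact gen_unit _ _ _ m1 m2 hn

/-- affine function -/
def affE (a b : ℂ) : EE := ⟨fun x => a + b * (x : ℝ), by fun_prop⟩

lemma hp_sub {p : ℝ → ℂ} (hp : IntervalIntegrable p volume 0 π) (lam : ℂ) :
    IntervalIntegrable (fun t => p t - lam) volume 0 π := hp.sub (by simp)

lemma exists_family (p : ℝ → ℂ) (hp : IntervalIntegrable p volume 0 π) (a b : ℂ) :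
    ∃ F : ℂ → EE, Differentiable ℂ F ∧ 
      (∀ lam, F lam = affE a b + Kop (fun t => p t - lam) (hp_sub hp lam) (F lam)) ∧
      (∀ lam f, f = affE a b + Kop (fun t => p t - lam) (hp_sub hp lam) f → f = F lam) := by
  have h1 : IntervalIntegrable (fun _ => (1:ℂ)) volume 0 π := by simp
  have hK : ∀ lam, Kop (fun t => p t - lam) (hp_sub hp lam) = Kop p hp - lam • Kop _ h1 := by
    intro lam
    ext f x
    simp only [sub_apply, ContinuousMap.sub_apply, 
      smul_apply, ContinuousMap.smul_apply, Kop_apply, KF, smul_eq_mul]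
    rw [← intervalIntegral.integral_const_mul, 
      ← intervalIntegral.integral_sub (KF_int p hp f x x.2) ((KF_int _ h1 f x x.2).const_mul _)]
    congr 1; ext t; ring
  have hu : ∀ lam, IsUnit (1 - (Kop p hp - lam • Kop _ h1)) := fun lam => by
    rw [← hK]; exact unit_one_sub _ _
  refine ⟨fun lam => Ring.inverse (1 - (Kop p hp - lam • Kop _ h1)) (affE a b), ?_, ?_, ?_⟩
  · exact gen_diff _ _ hu _
  · intro lam
    rw [hK]
    have := Ring.mul_inverse_cancel _ (hu lam)
    have h2 := congrArg (fun T : EE →L[ℂ] EE => T (affE a b)) this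
    simp only [mul_apply_eq_comp, one_apply_eq_self] at h2
    rw [sub_apply, one_apply_eq_self, sub_eq_iff_eq_add] at h2
    exact h2
  · intro lam f hf
    rw [hK] at hf
    have := Ring.inverse_mul_cancel _ (hu lam)
    have h2 := congrArg (fun T : EE →L[ℂ] EE => T f) this
    simp only [mul_apply_eq_comp, one_apply_eq_self] at h2
    rw [← h2]
    congr 1
    rw [sub_apply, one_apply_eq_self, sub_eq_iff_eq_add]
    exact hf



structure CSol (p : ℝ → ℂ) (lam a b : ℂ) (U V : ℝ → ℂ) : Prop where
  U0 : U 0 = a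
  cV : Continuous V
  dU : ∀ x, HasDerivAt U (V x) x
  V_eq : ∀ x ∈ Icc (0:ℝ) π, V x = b + ∫ t in (0:ℝ)..x, (p t - lam) * U t

lemma CSol.cU {p : ℝ → ℂ} {lam a b : ℂ} {U V : ℝ → ℂ} (h : CSol p lam a b U V) : Continuous U :=
  continuous_iff_continuousAt.2 fun t => (h.dU t).continuousAt

lemma CSol.ii {p : ℝ → ℂ} {lam a b : ℂ} {U V : ℝ → ℂ} (h : CSol p lam a b U V)
    (hp : IntervalIntegrable p volume 0 π) : 
    IntervalIntegrable (fun t => (p t - lam) * U t) volume 0 π :=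
  (hp_sub hp lam).mul_continuousOn h.cU.continuousOn

lemma CSol.U_int {p : ℝ → ℂ} {lam a b : ℂ} {U V : ℝ → ℂ} (h : CSol p lam a b U V) (x : ℝ) :
    ∫ t in (0:ℝ)..x, V t = U x - a := by
  rw [intervalIntegral.integral_eq_sub_of_hasDerivAt (fun t _ => h.dU t) 
    (h.cV.intervalIntegrable _ _), h.U0]

/-- prim integral identity -/
lemma prim_kernel (g : ℝ → ℂ) (x : ℝ) (hg : IntervalIntegrable g volume 0 x) :
    ∫ t in (0:ℝ)..x, ((x - t : ℝ) : ℂ) * g t = ∫ t in (0:ℝ)..x, ∫ r in (0:ℝ)..t, g r := by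
  rw [ibp g (fun t => ((x - t : ℝ) : ℂ)) (fun _ => -1) x hg ?_ continuous_const]
  · simp
  · intro t
    have : HasDerivAt (fun t : ℝ => x - t) (-1) t := by
      simpa using (hasDerivAt_id t).const_sub x
    simpa using! this.ofReal_comp

lemma CSol.fix {p : ℝ → ℂ} {lam a b : ℂ} {U V : ℝ → ℂ} (h : CSol p lam a b U V)
    (hp : IntervalIntegrable p volume 0 π) : 
    (⟨fun x => U x, h.cU.comp continuous_subtype_val⟩ : EE) = affE a b + 
      Kop (fun t => p t - lam) (hp_sub hp lam) ⟨fun x => U x, h.cU.comp continuous_subtype_val⟩ := by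
  ext x
  simp only [ContinuousMap.coe_mk, ContinuousMap.add_apply, Kop_apply, KF, affE]
  have hs : ∀ t ∈ uIcc 0 (x:ℝ), t ∈ Icc 0 π := by
    intro t ht
    rw [uIcc_of_le x.2.1] at ht
    exact ⟨ht.1, ht.2.trans x.2.2⟩
  have e1 : ∫ t in (0:ℝ)..x, ((x - t : ℝ) : ℂ) * ((p t - lam) * 
      ex ⟨fun x => U x, h.cU.comp continuous_subtype_val⟩ t) = 
      ∫ t in (0:ℝ)..x, ((x - t : ℝ) : ℂ) * ((p t - lam) * U t) := by
    apply intervalIntegral.integral_congr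
    intro t ht
    simp only
    rw [ex_apply _ (hs t ht)]; rfl
  have hi := ii_sub (h.ii hp) (sub_pi x.2)
  rw [e1, prim_kernel _ _ hi]
  have e2 := h.U_int x
  rw [intervalIntegral.integral_congr (fun t ht => h.V_eq t (hs t ht)), 
    intervalIntegral.integral_add (by simp) (ii_prim_cont _ _ hi).intervalIntegrable] at e2
  simp at e2
  linear_combination -e2

lemma fix_CSol {p : ℝ → ℂ} (hp : IntervalIntegrable p volume 0 π) {lam a b : ℂ} (f : EE)
    (hf : f = affE a b + Kop (fun t => p t - lam) (hp_sub hp lam) f) :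
    ∃ U V : ℝ → ℂ, CSol p lam a b U V ∧ (∀ x ∈ Icc (0:ℝ) π, U x = ex f x) := by
  have hg : IntervalIntegrable (fun t => (p t - lam) * ex f t) volume 0 π := mulE _ (hp_sub hp lam) f
  set G : ℝ → ℂ := fun x => ∫ t in (0:ℝ)..x, (p t - lam) * ex f t with hG
  have cG : ContinuousOn G (Icc 0 π) := by
    have := ii_prim_cont _ _ hg
    rwa [uIcc_of_le pi_pos.le] at this
  set V : ℝ → ℂ := IccExtend pi_pos.le ((Icc 0 π).domRestrict (fun x => b + G x)) with hV
  have cV : Continuous V := by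
    apply Continuous.Icc_extend'
    exact (continuousOn_const.add cG).domRestrict
  have V_eq : ∀ x ∈ Icc (0:ℝ) π, V x = b + G x := fun x hx => by
    rw [hV, IccExtend_of_mem _ _ hx]; rfl
  set U : ℝ → ℂ := fun x => a + ∫ t in (0:ℝ)..x, V t with hU
  have U_eq : ∀ x ∈ Icc (0:ℝ) π, U x = ex f x := by
    intro x hx
    have hs : ∀ t ∈ uIcc 0 (x:ℝ), t ∈ Icc 0 π := by
      intro t ht
      rw [uIcc_of_le hx.1] at ht
      exact ⟨ht.1, ht.2.trans hx.2⟩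
    have hi := ii_sub hg (sub_pi hx)
    have h1 := congrArg (fun f : EE => f ⟨x, hx⟩) hf
    simp only [ContinuousMap.add_apply, Kop_apply, KF] at h1
    rw [prim_kernel _ _ hi] at h1
    rw [ex_apply _ hx, h1, hU]
    simp only
    rw [intervalIntegral.integral_congr (fun t ht => V_eq t (hs t ht)), 
    intervalIntegral.integral_add (by simp) (ii_prim_cont _ _ hi).intervalIntegrable]
    simp [affE]
    ring
  refine ⟨U, V, ⟨by simp [hU], cV, ?_, ?_⟩, U_eq⟩
  · intro x
    exact (cV.integral_hasStrictDerivAt 0 x).hasDerivAt.const_add a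
  · intro x hx
    rw [V_eq x hx, hG]
    simp only
    congr 1
    apply intervalIntegral.integral_congr
    intro t ht
    rw [uIcc_of_le hx.1] at ht
    simp only
    rw [U_eq t ⟨ht.1, ht.2.trans hx.2⟩]

def Lf (p : ℝ → ℂ) (hp : IntervalIntegrable p volume 0 π) : EE →L[ℂ] ℂ :=
  LinearMap.mkContinuous
    { toFun := fun f => ∫ t in (0:ℝ)..π, p t * ex f t
      map_add' := by
        intro f g
        rw [← intervalIntegral.integral_add (mulE p hp f) (mulE p hp g)]
        congr 1; ext t; simp [ex, IccExtend]; ring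
      map_smul' := by
        intro c f
        simp only [RingHom.id_apply, smul_eq_mul]
        rw [← intervalIntegral.integral_const_mul]
        congr 1; ext t; simp [ex, IccExtend]; ring }
    (∫ t in (0:ℝ)..π, ‖p t‖) (by
      intro f
      have := KF_bound p hp (fun _ => 1) 1 f π ⟨pi_pos.le, le_rfl⟩ (by simp)
      simpa using! this)

lemma Lf_apply (p : ℝ → ℂ) (hp : IntervalIntegrable p volume 0 π) (f : EE) :
   Lf p hp f = ∫ t in (0:ℝ)..π, p t * ex f t := rfl

lemma diff_clm {E : Type*} [NormedAddCommGroup E] [NormedSpace ℂ E] (L : E →L[ℂ] ℂ) (F : ℂ → E)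
    (hF : Differentiable ℂ F) : Differentiable ℂ (fun z => L (F z)) :=
  fun z => L.differentiableAt.comp z (hF z)

lemma pi_mem : π ∈ Icc (0:ℝ) π := ⟨pi_pos.le, le_rfl⟩

theorem main_family (p : ℝ → ℂ) (hp : IntervalIntegrable p volume 0 π) (a b : ℂ) :
    ∃ U V : ℂ → ℝ → ℂ, (∀ lam, CSol p lam a b (U lam) (V lam)) ∧
      Differentiable ℂ (fun lam => U lam π) ∧ Differentiable ℂ (fun lam => V lam π) ∧
      (∀ h : ℝ → ℂ, Continuous h → Continuous fun lam => ∫ t in (0:ℝ)..π, h t * U lam t) ∧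
      (∀ lam U' V', CSol p lam a b U' V' → 
        (∀ x ∈ Icc (0:ℝ) π, U' x = U lam x) ∧ V' π = V lam π) := by
  obtain ⟨F, dF, hF, huniq⟩ := exists_family p hp a b
  choose U V hs hU using fun lam => fix_CSol hp (F lam) (hF lam)
  have i1 : IntervalIntegrable (fun _ => (1:ℂ)) volume 0 π := by simp
  refine ⟨U, V, hs, ?_, ?_, ?_, ?_⟩
  · have : (fun lam => U lam π) = fun lam => ContinuousMap.evalCLM ℂ (⟨π, pi_mem⟩ : Icc (0:ℝ) π) (F lam) := by
      ext lam
      rw [hU lam π pi_mem, ex_apply _ pi_mem]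
      rfl
    rw [this]
    exact diff_clm _ _ dF
  · have : (fun lam => V lam π) = fun lam => b + (Lf p hp (F lam) - lam * Lf _ i1 (F lam)) := by
      ext lam
      rw [(hs lam).V_eq π pi_mem, Lf_apply, Lf_apply]
      congr 1
      rw [← intervalIntegral.integral_const_mul, 
        ← intervalIntegral.integral_sub (mulE _ hp _) ((mulE _ i1 _).const_mul _)]
      apply intervalIntegral.integral_congr
      intro t ht
      rw [uIcc_of_le pi_pos.le] at ht
      simp only
      rw [hU lam t ht]; ring
    rw [this]
    have h1 := diff_clm (Lf p hp) _ dF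
    have h2 := diff_clm (Lf _ i1) _ dF
    fun_prop
  · intro h hh
    have ih : IntervalIntegrable h volume 0 π := hh.intervalIntegrable _ _
    have : (fun lam => ∫ t in (0:ℝ)..π, h t * U lam t) = fun lam => Lf h ih (F lam) := by
      ext lam
      rw [Lf_apply]
      apply intervalIntegral.integral_congr
      intro t ht
      rw [uIcc_of_le pi_pos.le] at ht
      simp only
      rw [hU lam t ht]
    rw [this]
    exact (diff_clm _ _ dF).continuous
  · intro lam U' V' h'
    have e := huniq lam _ (h'.fix hp)
    have hUU : ∀ x ∈ Icc (0:ℝ) π, U' x = U lam x := by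
      intro x hx
      rw [hU lam x hx, ex_apply _ hx, ← e]
      rfl
    refine ⟨hUU, ?_⟩
    rw [h'.V_eq π pi_mem, (hs lam).V_eq π pi_mem]
    congr 1
    apply intervalIntegral.integral_congr
    intro t ht
    rw [uIcc_of_le pi_pos.le] at ht
    simp only
    rw [hUU t ht]

/-- Wronskian -/
lemma wronsk {p : ℝ → ℂ} (hp : IntervalIntegrable p volume 0 π) {lam mu a b : ℂ} 
    {U V U2 V2 : ℝ → ℂ} (h : CSol p lam a b U V) (h2 : CSol p mu a b U2 V2) :
    U π * V2 π - V π * U2 π = (lam - mu) * ∫ t in (0:ℝ)..π, U2 t * U t := by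
  have e1 := ibp _ _ _ π (h2.ii hp) h.dU h.cV
  have e2 := ibp _ _ _ π (h.ii hp) h2.dU h2.cV
  have f1 : ∫ t in (0:ℝ)..π, V t * ∫ r in (0:ℝ)..t, (p r - mu) * U2 r = 
      (∫ t in (0:ℝ)..π, V t * V2 t) - b * (U π - a) := by
    rw [← h.U_int, ← intervalIntegral.integral_const_mul, ← intervalIntegral.integral_sub]
    · apply intervalIntegral.integral_congr
      intro t ht
      rw [uIcc_of_le pi_pos.le] at ht
      simp only
      rw [h2.V_eq t ht]; ring
    · exact (h.cV.mul h2.cV).intervalIntegrable _ _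
    · exact (h.cV.intervalIntegrable _ _).const_mul _
  have f2 : ∫ t in (0:ℝ)..π, V2 t * ∫ r in (0:ℝ)..t, (p r - lam) * U r = 
      (∫ t in (0:ℝ)..π, V t * V2 t) - b * (U2 π - a) := by
    rw [← h2.U_int, ← intervalIntegral.integral_const_mul, ← intervalIntegral.integral_sub]
    · apply intervalIntegral.integral_congr
      intro t ht
      rw [uIcc_of_le pi_pos.le] at ht
      simp only
      rw [h.V_eq t ht]; ring
    · exact (h.cV.mul h2.cV).intervalIntegrable _ _
    · exact (h2.cV.intervalIntegrable _ _).const_mul _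
  have g1 := h.V_eq π pi_mem
  have g2 := h2.V_eq π pi_mem
  rw [f1] at e1
  rw [f2] at e2
  have k : (lam - mu) * ∫ t in (0:ℝ)..π, U2 t * U t = 
    (∫ t in (0:ℝ)..π, U t * ((p t - mu) * U2 t)) - ∫ t in (0:ℝ)..π, U2 t * ((p t - lam) * U t) := by
    rw [← intervalIntegral.integral_const_mul, ← intervalIntegral.integral_sub]
    · congr 1; ext t; ring
    · exact (h2.ii hp).continuousOn_mul h.cU.continuousOn
    · exact (h.ii hp).continuousOn_mul h2.cU.continuousOn
  rw [k, e1, e2]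
  linear_combination U π * g2 - U2 π * g1

/-- variation of constants -/
lemma voc {p : ℝ → ℂ} (hp : IntervalIntegrable p volume 0 π) {s a b : ℂ} (hs : s ≠ 0)
    {U V : ℝ → ℂ} (h : CSol p (s^2) a b U V) (x : ℝ) (hx : x ∈ Icc (0:ℝ) π) :
    U x = a * Complex.cos (s * x) + b * (Complex.sin (s * x) / s) + 
      ∫ t in (0:ℝ)..x, (Complex.sin (s * (x - t)) / s) * (p t * U t) := by
  have hi := ii_sub (h.ii hp) (sub_pi hx)
  have hpU : IntervalIntegrable (fun t => p t * U t) volume 0 x :=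
    ii_sub (hp.mul_continuousOn h.cU.continuousOn) (sub_pi hx)
  have ds : ∀ t : ℝ, HasDerivAt (fun t : ℝ => Complex.sin (s * (x - t)) / s) 
      (- Complex.cos (s * (x - t))) t := by
    intro t
    have h1 : HasDerivAt (fun t : ℝ => s * ((x:ℂ) - t)) (s * (-1)) t := by
      have := (Complex.ofRealCLM.hasDerivAt (x := t)).const_sub (x:ℂ)
      simpa using! this.const_mul s
    have h2 := ((Complex.hasDerivAt_sin _).comp t h1).div_const s
    convert! h2 using 1
    field_simp
  have dc : ∀ t : ℝ, HasDerivAt (fun t : ℝ => Complex.cos (s * (x - t))) 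
      (s * Complex.sin (s * (x - t))) t := by
    intro t
    have h1 : HasDerivAt (fun t : ℝ => s * ((x:ℂ) - t)) (s * (-1)) t := by
      have := (Complex.ofRealCLM.hasDerivAt (x := t)).const_sub (x:ℂ)
      simpa using! this.const_mul s
    have h2 := (Complex.hasDerivAt_cos _).comp t h1
    convert! h2 using 1
    ring
  have e1 := ibp _ _ _ x hi ds (by fun_prop)
  -- classical ibp
  have e2 : ∫ t in (0:ℝ)..x, (s * Complex.sin (s * (x - t)) * U t + Complex.cos (s * (x - t)) * V t)
     = U x - Complex.cos (s * x) * a := by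
    rw [intervalIntegral.integral_eq_sub_of_hasDerivAt (fun t _ => (dc t).mul (h.dU t))]
    · simp [h.U0]
    · have := h.cU; have := h.cV
      exact Continuous.intervalIntegrable (by fun_prop) _ _
  have e3 : ∫ t in (0:ℝ)..x, -Complex.cos (s * (x - t)) = - (Complex.sin (s * x) / s) := by
    rw [intervalIntegral.integral_eq_sub_of_hasDerivAt (fun t _ => ds t)]
    · simp
    · exact Continuous.intervalIntegrable (by fun_prop) _ _
  have hcV := h.cV
  have hcU := h.cU
  have e4 : ∫ t in (0:ℝ)..x, -Complex.cos (s * (x - t)) * ∫ r in (0:ℝ)..t, (p r - s^2) * U r = 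
     b * (Complex.sin (s * x) / s) - ∫ t in (0:ℝ)..x, Complex.cos (s * (x - t)) * V t := by
    have : b * (Complex.sin (s * x) / s) = b * ∫ t in (0:ℝ)..x, Complex.cos (s * (x - t)) := by
      rw [intervalIntegral.integral_neg] at e3
      rw [neg_inj.1 e3]
    rw [this, ← intervalIntegral.integral_const_mul, ← intervalIntegral.integral_sub]
    · apply intervalIntegral.integral_congr
      intro t ht
      rw [uIcc_of_le hx.1] at ht
      simp only
      rw [h.V_eq t ⟨ht.1, ht.2.trans hx.2⟩]; ring
    · exact Continuous.intervalIntegrable (by fun_prop) _ _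
    · exact Continuous.intervalIntegrable (by fun_prop) _ _
  rw [intervalIntegral.integral_add (Continuous.intervalIntegrable (by fun_prop) _ _) 
    (Continuous.intervalIntegrable (by fun_prop) _ _)] at e2
  have e5 : ∫ t in (0:ℝ)..x, Complex.sin (s * (x - t)) / s * ((p t - s^2) * U t) = 
     (∫ t in (0:ℝ)..x, (Complex.sin (s * (x - t)) / s) * (p t * U t)) - 
      ∫ t in (0:ℝ)..x, s * Complex.sin (s * (x - t)) * U t := by
    rw [← intervalIntegral.integral_sub]
    · congr 1; ext t; field_simp
    · exact hpU.continuousOn_mul (by fun_prop)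
    · exact Continuous.intervalIntegrable (by fun_prop) _ _
  rw [e4, e5] at e1
  simp only [sub_self, mul_zero, Complex.sin_zero, zero_div, zero_mul, zero_sub] at e1
  linear_combination -e2 - e1

lemma voc' {p : ℝ → ℂ} (hp : IntervalIntegrable p volume 0 π) {s a b : ℂ} 
    {U V : ℝ → ℂ} (h : CSol p (s^2) a b U V) (x : ℝ) (hx : x ∈ Icc (0:ℝ) π) :
    V x = - a * s * Complex.sin (s * x) + b * Complex.cos (s * x) + 
      ∫ t in (0:ℝ)..x, Complex.cos (s * (x - t)) * (p t * U t) := by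
  have hi := ii_sub (h.ii hp) (sub_pi hx)
  have hpU : IntervalIntegrable (fun t => p t * U t) volume 0 x :=
    ii_sub (hp.mul_continuousOn h.cU.continuousOn) (sub_pi hx)
  have ds : ∀ t : ℝ, HasDerivAt (fun t : ℝ => s * Complex.sin (s * (x - t))) 
      (- s ^ 2 * Complex.cos (s * (x - t))) t := by
    intro t
    have h1 : HasDerivAt (fun t : ℝ => s * ((x:ℂ) - t)) (s * (-1)) t := by
      have := (Complex.ofRealCLM.hasDerivAt (x := t)).const_sub (x:ℂ)
      simpa using! this.const_mul s
    have h2 := ((Complex.hasDerivAt_sin _).comp t h1).const_mul s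
    convert! h2 using 1
    ring
  have dc : ∀ t : ℝ, HasDerivAt (fun t : ℝ => Complex.cos (s * (x - t))) 
      (s * Complex.sin (s * (x - t))) t := by
    intro t
    have h1 : HasDerivAt (fun t : ℝ => s * ((x:ℂ) - t)) (s * (-1)) t := by
      have := (Complex.ofRealCLM.hasDerivAt (x := t)).const_sub (x:ℂ)
      simpa using! this.const_mul s
    have h2 := (Complex.hasDerivAt_cos _).comp t h1
    convert! h2 using 1
    ring
  have hcV := h.cV
  have hcU := h.cU
  have e1 := ibp _ _ _ x hi dc (by fun_prop)
  have e2 : ∫ t in (0:ℝ)..x, (- s ^ 2 * Complex.cos (s * (x - t)) * U t + s * Complex.sin (s * (x - t)) * V t)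
     = - s * Complex.sin (s * x) * a := by
    rw [intervalIntegral.integral_eq_sub_of_hasDerivAt (fun t _ => (ds t).mul (h.dU t))]
    · simp [h.U0]
    · exact Continuous.intervalIntegrable (by fun_prop) _ _
  have e3 : ∫ t in (0:ℝ)..x, s * Complex.sin (s * (x - t)) = 1 - Complex.cos (s * x) := by
    rw [intervalIntegral.integral_eq_sub_of_hasDerivAt (fun t _ => dc t)]
    · simp
    · exact Continuous.intervalIntegrable (by fun_prop) _ _
  have e4 : ∫ t in (0:ℝ)..x, s * Complex.sin (s * (x - t)) * ∫ r in (0:ℝ)..t, (p r - s^2) * U r = 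
     (∫ t in (0:ℝ)..x, s * Complex.sin (s * (x - t)) * V t) - b * (1 - Complex.cos (s * x)) := by
    rw [← e3, ← intervalIntegral.integral_const_mul, ← intervalIntegral.integral_sub]
    · apply intervalIntegral.integral_congr
      intro t ht
      rw [uIcc_of_le hx.1] at ht
      simp only
      rw [h.V_eq t ⟨ht.1, ht.2.trans hx.2⟩]; ring
    · exact Continuous.intervalIntegrable (by fun_prop) _ _
    · exact Continuous.intervalIntegrable (by fun_prop) _ _
  rw [intervalIntegral.integral_add (Continuous.intervalIntegrable (by fun_prop) _ _) 
    (Continuous.intervalIntegrable (by fun_prop) _ _)] at e2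
  have e5 : ∫ t in (0:ℝ)..x, Complex.cos (s * (x - t)) * ((p t - s^2) * U t) = 
     (∫ t in (0:ℝ)..x, Complex.cos (s * (x - t)) * (p t * U t)) + 
      ∫ t in (0:ℝ)..x, - s ^ 2 * Complex.cos (s * (x - t)) * U t := by
    rw [← intervalIntegral.integral_add]
    · congr 1; ext t; ring
    · exact hpU.continuousOn_mul (by fun_prop)
    · exact Continuous.intervalIntegrable (by fun_prop) _ _
  have e6 := h.V_eq x hx
  rw [e4, e5] at e1
  simp only [sub_self, mul_zero, Complex.cos_zero, one_mul] at e1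
  linear_combination e6 - e1 + e2



lemma norm_cos_le (z : ℂ) : ‖Complex.cos z‖ ≤ Real.exp |z.im| := by
  rw [Complex.cos, norm_div]
  have h1 : ‖Complex.exp (z * Complex.I)‖ ≤ Real.exp |z.im| := by
    rw [Complex.norm_exp]; apply Real.exp_le_exp.2; simp; exact neg_le_abs _
  have h2 : ‖Complex.exp (-z * Complex.I)‖ ≤ Real.exp |z.im| := by
    rw [Complex.norm_exp]; apply Real.exp_le_exp.2; simp; exact le_abs_self _
  have := norm_add_le (Complex.exp (z * Complex.I)) (Complex.exp (-z * Complex.I))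
  simp only [Complex.norm_ofNat]
  linarith

lemma norm_sin_le (z : ℂ) : ‖Complex.sin z‖ ≤ Real.exp |z.im| := by
  have := norm_cos_le (z - π / 2)
  rw [Complex.cos_sub_pi_div_two] at this
  simpa using this

lemma norm_cos_mul_le (s : ℂ) (x : ℝ) (hx : 0 ≤ x) : ‖Complex.cos (s * x)‖ ≤ Real.exp (|s.im| * x) := by
  have := norm_cos_le (s * x)
  simpa [abs_mul, abs_of_nonneg hx] using this

lemma norm_sin_mul_le (s : ℂ) (x : ℝ) (hx : 0 ≤ x) : ‖Complex.sin (s * x)‖ ≤ Real.exp (|s.im| * x) := by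
  have := norm_sin_le (s * x)
  simpa [abs_mul, abs_of_nonneg hx] using this

lemma vol_bound {p : ℝ → ℂ} (hp : IntervalIntegrable p volume 0 π) (k U : ℝ → ℂ)
    (τ c M x : ℝ) (hc : 0 ≤ c) (hM : 0 ≤ M) (hx : x ∈ Icc (0:ℝ) π)
    (hk : ∀ t ∈ Icc 0 x, ‖k t‖ ≤ c * Real.exp (τ * (x - t)))
    (hU : ∀ t ∈ Icc 0 x, ‖U t‖ ≤ M * Real.exp (τ * t)) :
    ‖∫ t in (0:ℝ)..x, k t * (p t * U t)‖ ≤ c * M * Real.exp (τ * x) * ∫ t in (0:ℝ)..π, ‖p t‖ := by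
  have hpx := ii_sub hp (sub_pi hx)
  calc ‖∫ t in (0:ℝ)..x, k t * (p t * U t)‖ 
      ≤ ∫ t in (0:ℝ)..x, (c * M * Real.exp (τ * x)) * ‖p t‖ := by
        apply intervalIntegral.norm_integral_le_of_norm_le hx.1
        · refine Filter.Eventually.of_forall fun t ht => ?_
          rw [norm_mul, norm_mul]
          have h1 := hk t ⟨ht.1.le, ht.2⟩
          have h2 := hU t ⟨ht.1.le, ht.2⟩
          calc ‖k t‖ * (‖p t‖ * ‖U t‖) 
             ≤ (c * Real.exp (τ * (x - t))) * (‖p t‖ * (M * Real.exp (τ * t))) := by gcongr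
            _ = c * M * (Real.exp (τ * (x - t)) * Real.exp (τ * t)) * ‖p t‖ := by ring
            _ = _ := by rw [← Real.exp_add]; congr 3; ring
        · exact hpx.norm.const_mul _
    _ = (c * M * Real.exp (τ * x)) * ∫ t in (0:ℝ)..x, ‖p t‖ := by 
        rw [intervalIntegral.integral_const_mul]
    _ ≤ (c * M * Real.exp (τ * x)) * ∫ t in (0:ℝ)..π, ‖p t‖ := by
        gcongr
        apply intervalIntegral.integral_mono_interval le_rfl hx.1 hx.2
        · exact Filter.Eventually.of_forall fun t => norm_nonneg _
        · exact hp.norm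

lemma U_bound {p : ℝ → ℂ} (hp : IntervalIntegrable p volume 0 π) {s a b : ℂ} 
    (hs1 : 1 ≤ ‖s‖) (hs2 : 2 * (∫ t in (0:ℝ)..π, ‖p t‖) ≤ ‖s‖)
    {U V : ℝ → ℂ} (h : CSol p (s^2) a b U V) (x : ℝ) (hx : x ∈ Icc (0:ℝ) π) :
    ‖U x‖ ≤ 2 * (‖a‖ + ‖b‖) * Real.exp (|s.im| * x) := by
  have P0 : 0 ≤ ∫ t in (0:ℝ)..π, ‖p t‖ :=
    intervalIntegral.integral_nonneg pi_pos.le fun t _ => norm_nonneg _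
  set P := ∫ t in (0:ℝ)..π, ‖p t‖ with hP
  have spos : 0 < ‖s‖ := by linarith
  have s0 : s ≠ 0 := norm_pos_iff.1 spos
  set τ := |s.im| with hτ
  have cont : ContinuousOn (fun x : ℝ => ‖U x‖ * Real.exp (-(τ * x))) (Icc 0 π) := by
    have := h.cU
    fun_prop
  obtain ⟨x0, hx0, hmax⟩ := isCompact_Icc.exists_isMaxOn ⟨0, left_mem_Icc.2 pi_pos.le⟩ cont
  set M := ‖U x0‖ * Real.exp (-(τ * x0)) with hM
  have M0 : 0 ≤ M := by positivity
  have hU : ∀ t ∈ Icc 0 π, ‖U t‖ ≤ M * Real.exp (τ * t) := by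
    intro t ht
    have h1 : ‖U t‖ * Real.exp (-(τ * t)) ≤ M := hmax ht
    have h2 : ‖U t‖ = (‖U t‖ * Real.exp (-(τ * t))) * Real.exp (τ * t) := by
      rw [mul_assoc, ← Real.exp_add]; simp
    rw [h2]
    gcongr
  have e := voc hp s0 h x0 hx0
  have b1 := norm_cos_mul_le s x0 hx0.1
  have b2 := norm_sin_mul_le s x0 hx0.1
  have b3 := vol_bound hp (fun t : ℝ => Complex.sin (s * (x0 - t)) / s) U τ (1 / ‖s‖) M x0 
    (by positivity) M0 hx0 (by
      intro t ht
      rw [norm_div, div_eq_mul_one_div, mul_comm]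
      gcongr
      have := norm_sin_mul_le s (x0 - t) (sub_nonneg.2 ht.2)
      simpa using this) (fun t ht => hU t ⟨ht.1, ht.2.trans hx0.2⟩)
  have key : ‖U x0‖ ≤ (‖a‖ + ‖b‖ + M / 2) * Real.exp (τ * x0) := by
    rw [e]
    refine (norm_add₃_le).trans ?_
    rw [norm_mul, norm_mul, norm_div]
    have c2 : ‖Complex.sin (s * x0)‖ / ‖s‖ ≤ Real.exp (τ * x0) :=
      (div_le_self (norm_nonneg _) hs1).trans b2
    have c3 : 1 / ‖s‖ * M * Real.exp (τ * x0) * P ≤ M / 2 * Real.exp (τ * x0) := by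
      have : P / ‖s‖ ≤ 1 / 2 := by rw [div_le_div_iff₀ spos (by norm_num)]; linarith
      calc 1 / ‖s‖ * M * Real.exp (τ * x0) * P = (P / ‖s‖) * (M * Real.exp (τ * x0)) := by ring
        _ ≤ 1 / 2 * (M * Real.exp (τ * x0)) := by gcongr
        _ = _ := by ring
    have d1 := mul_le_mul_of_nonneg_left b1 (norm_nonneg a)
    have d2 := mul_le_mul_of_nonneg_left c2 (norm_nonneg b)
    linarith
  have hMM : M ≤ ‖a‖ + ‖b‖ + M / 2 := by
    have h2 : M = ‖U x0‖ / Real.exp (τ * x0) := by rw [hM, Real.exp_neg, div_eq_mul_inv]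
    exact h2.trans_le ((div_le_iff₀ (Real.exp_pos _)).2 key)
  refine (hU x hx).trans ?_
  gcongr
  linarith

theorem asymp {p : ℝ → ℂ} (hp : IntervalIntegrable p volume 0 π) (a b cb sb : ℂ) :
    ∃ C s0 : ℝ, 0 < C ∧ 1 ≤ s0 ∧ ∀ s : ℂ, s0 ≤ ‖s‖ → ∀ U V, CSol p (s^2) a b U V → 
      ‖cb * U π + sb * V π + a * sb * s * Complex.sin (s * π)‖ ≤ C * Real.exp (|s.im| * π) := by
  set P := ∫ t in (0:ℝ)..π, ‖p t‖ with hP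
  have P0 : 0 ≤ P :=
    intervalIntegral.integral_nonneg pi_pos.le fun t _ => norm_nonneg _
  set M := 2 * (‖a‖ + ‖b‖) with hM
  have M0 : 0 ≤ M := by positivity
  refine ⟨‖cb‖ * M + ‖sb‖ * (‖b‖ + M * P) + 1, max 1 (2 * P), by positivity, le_max_left _ _, ?_⟩
  intro s hs U V h
  have hs1 := (le_max_left _ _).trans hs
  have hs2 := (le_max_right _ _).trans hs
  have hU := U_bound hp hs1 hs2 h
  have e := voc' hp h π pi_mem
  have b3 := vol_bound hp (fun t : ℝ => Complex.cos (s * (π - t))) U |s.im| 1 M π 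
    (by positivity) M0 pi_mem (by
      intro t ht
      have := norm_cos_mul_le s (π - t) (sub_nonneg.2 ht.2)
      simpa using this) hU
  have b1 := norm_cos_mul_le s π pi_pos.le
  have e' : cb * U π + sb * V π + a * sb * s * Complex.sin (s * π) = 
    cb * U π + sb * (b * Complex.cos (s * π) + 
      ∫ t in (0:ℝ)..π, Complex.cos (s * (π - t)) * (p t * U t)) := by
    rw [e]; ring
  rw [e']
  refine (norm_add_le _ _).trans ?_
  rw [norm_mul, norm_mul]
  have b4 := norm_add_le (b * Complex.cos (s * π)) (∫ t in (0:ℝ)..π, Complex.cos (s * (π - t)) * (p t * U t))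
  rw [norm_mul] at b4
  have b5 : ‖b * Complex.cos (s * π) + ∫ t in (0:ℝ)..π, Complex.cos (s * (π - t)) * (p t * U t)‖ 
     ≤ (‖b‖ + M * P) * Real.exp (|s.im| * π) := by
    have d1 := mul_le_mul_of_nonneg_left b1 (norm_nonneg b)
    linarith
  have d1 := mul_le_mul_of_nonneg_left (hU π pi_mem) (norm_nonneg cb)
  have d2 := mul_le_mul_of_nonneg_left b5 (norm_nonneg sb)
  have := Real.exp_pos (|s.im| * π)
  linarith

lemma CSol.conj {p : ℝ → ℝ} {lam : ℂ} {a b : ℝ} {U V : ℝ → ℂ}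
    (hp : IntervalIntegrable (fun t => (p t : ℂ)) volume 0 π)
    (h : CSol (fun t => p t) lam a b U V) :
    CSol (fun t => p t) (starRingEnd ℂ lam) a b (fun t => starRingEnd ℂ (U t)) (fun t => starRingEnd ℂ (V t)) := by
  refine ⟨by simp [h.U0], Complex.continuous_conj.comp h.cV, ?_, ?_⟩
  · intro x
    exact (Complex.conjCLE.toContinuousLinearMap.hasFDerivAt.comp_hasDerivAt x (h.dU x))
  · intro x hx
    rw [h.V_eq x hx]
    simp only [map_add, Complex.conj_ofReal]
    congr 1
    have := Complex.conjCLE.toContinuousLinearMap.intervalIntegral_comp_comm (ii_sub (h.ii hp) (sub_pi hx))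
    simp at this
    rw [← this]

lemma normsq_int_ne {U : ℝ → ℂ} (cU : Continuous U) (h0 : U 0 ≠ 0) :
    ∫ t in (0:ℝ)..π, starRingEnd ℂ (U t) * U t ≠ 0 := by
  have : ∀ t, starRingEnd ℂ (U t) * U t = ((Complex.normSq (U t) : ℝ) : ℂ) := by
    intro t; rw [mul_comm, Complex.mul_conj]
  simp_rw [this]
  rw [intervalIntegral.integral_ofReal]
  have : 0 < ∫ t in (0:ℝ)..π, Complex.normSq (U t) := by
    apply intervalIntegral.integral_pos pi_pos
    · exact (Complex.continuous_normSq.comp cU).continuousOn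
    · intro t _; exact Complex.normSq_nonneg _
    · exact ⟨0, ⟨le_rfl, pi_pos.le⟩, Complex.normSq_pos.2 h0⟩
  exact_mod_cast this.ne'

lemma zero_real {p : ℝ → ℝ} {lam : ℂ} {a b cb sb : ℝ} {U V : ℝ → ℂ}
    (hp : IntervalIntegrable (fun t => (p t : ℂ)) volume 0 π)
    (h : CSol (fun t => p t) lam a b U V) (ha : a ≠ 0) (hsb : sb ≠ 0)
    (hz : cb * U π + sb * V π = 0) : starRingEnd ℂ lam = lam := by
  have w := wronsk hp h (h.conj hp)
  have hz2 := congrArg (starRingEnd ℂ) hz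
  simp only [map_add, map_mul, Complex.conj_ofReal, map_zero] at hz2
  have hI := normsq_int_ne h.cU (by rw [h.U0]; exact_mod_cast ha)
  have hsb' : (sb : ℂ) ≠ 0 := by exact_mod_cast hsb
  have : U π * starRingEnd ℂ (V π) - V π * starRingEnd ℂ (U π) = 0 := by
    apply mul_left_cancel₀ hsb'
    linear_combination U π * hz2 - starRingEnd ℂ (U π) * hz
  rw [this] at w
  have := (mul_eq_zero.1 w.symm).resolve_right hI
  exact (sub_eq_zero.1 this).symm

lemma zero_simple {p : ℝ → ℝ} {mu : ℂ} {a b cb sb : ℝ} {U V : ℂ → ℝ → ℂ}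
    (hp : IntervalIntegrable (fun t => (p t : ℂ)) volume 0 π)
    (h : ∀ lam, CSol (fun t => p t) lam a b (U lam) (V lam)) (ha : a ≠ 0) (hsb : sb ≠ 0)
    (hd : Differentiable ℂ fun lam => cb * U lam π + sb * V lam π)
    (hc : ∀ h : ℝ → ℂ, Continuous h → Continuous fun lam => ∫ t in (0:ℝ)..π, h t * U lam t)
    (hz : cb * U mu π + sb * V mu π = 0) : 
    deriv (fun lam => cb * U lam π + sb * V lam π) mu ≠ 0 := by
  have hmu := zero_real hp (h mu) ha hsb hz
  have hcj := (h mu).conj hp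
  rw [hmu] at hcj
  have hz2 := congrArg (starRingEnd ℂ) hz
  simp only [map_add, map_mul, Complex.conj_ofReal, map_zero] at hz2
  have hI := normsq_int_ne (h mu).cU (by rw [(h mu).U0]; exact_mod_cast ha)
  have hsb' : (sb : ℂ) ≠ 0 := by exact_mod_cast hsb
  have hcI := hc (fun t => starRingEnd ℂ (U mu t)) (Complex.continuous_conj.comp (h mu).cU)
  have key : ∀ lam, - starRingEnd ℂ (U mu π) * (cb * U lam π + sb * V lam π) = 
     sb * ((lam - mu) * ∫ t in (0:ℝ)..π, starRingEnd ℂ (U mu t) * U lam t) := by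
    intro lam
    rw [← wronsk hp (h lam) hcj]
    linear_combination (-U lam π) * hz2
  intro hder
  have d1 := ((hd mu).hasDerivAt.const_mul (- starRingEnd ℂ (U mu π)))
  rw [hder, mul_zero] at d1
  simp_rw [key] at d1
  rw [hasDerivAt_iff_tendsto_slope] at d1
  have d2 : Filter.Tendsto (fun lam => sb * ∫ t in (0:ℝ)..π, starRingEnd ℂ (U mu t) * U lam t) 
    (nhdsWithin mu {mu}ᶜ) (nhds (sb * ∫ t in (0:ℝ)..π, starRingEnd ℂ (U mu t) * U mu t)) :=
    ((hcI.tendsto mu).const_mul _).mono_left nhdsWithin_le_nhds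
  have d3 := tendsto_nhds_unique (d1.congr' ?_) d2
  · exact (mul_ne_zero hsb' hI) d3.symm
  · filter_upwards [self_mem_nhdsWithin] with lam hlam
    have : lam - mu ≠ 0 := sub_ne_zero.2 hlam
    simp only [slope_def_field, sub_self, zero_mul, mul_zero, sub_zero]
    field_simp



lemma real_CSol {q : ℝ → ℝ} (hq : IntervalIntegrable q volume 0 π) (c0 : ℝ) {lam : ℝ} {y y' : ℝ → ℝ}
    (h : IsSol q lam y y') : ∃ U V : ℝ → ℂ,
    CSol (fun t => ((q t - c0 : ℝ) : ℂ)) ((lam - c0 : ℝ) : ℂ) (y 0) (y' 0) U V ∧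
    (∀ x ∈ Icc (0:ℝ) π, U x = y x) ∧ V π = y' π := by
  have hy : ContinuousOn y (Icc 0 π) := fun x hx => (h.1 x hx).continuousAt.continuousWithinAt
  have hi : IntervalIntegrable (fun t => (q t - lam) * y t) volume 0 π := by
    apply IntervalIntegrable.mul_continuousOn
    · exact hq.sub (by simp)
    · rwa [uIcc_of_le pi_pos.le]
  have cy' : ContinuousOn y' (Icc 0 π) := by
    have := intervalIntegral.continuousOn_primitive_interval' hi (a := 0) (by simp)
    rw [uIcc_of_le pi_pos.le] at this
    exact (continuousOn_const.add this).congr h.2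
  set W : ℝ → ℝ := fun x => y' (projIcc 0 π pi_pos.le x) with hW
  have cW : Continuous W := by
    have : Continuous ((Icc 0 π).domRestrict y') := continuousOn_iff_continuous_domRestrict.1 cy'
    exact this.comp continuous_projIcc
  have We : ∀ x ∈ Icc 0 π, W x = y' x := by
    intro x hx
    simp [hW, projIcc_of_mem _ hx]
  set Y : ℝ → ℝ := fun x => y 0 + ∫ t in (0:ℝ)..x, W t with hY
  have Ye : ∀ x ∈ Icc 0 π, Y x = y x := by
    intro x hx
    have e1 : ∫ t in (0:ℝ)..x, W t = ∫ t in (0:ℝ)..x, y' t := by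
      apply intervalIntegral.integral_congr
      intro t ht
      rw [uIcc_of_le hx.1] at ht
      exact We t ⟨ht.1, ht.2.trans hx.2⟩
    have e2 : ∫ t in (0:ℝ)..x, y' t = y x - y 0 := by
      apply intervalIntegral.integral_eq_sub_of_hasDerivAt
      · intro t ht
        rw [uIcc_of_le hx.1] at ht
        exact h.1 t ⟨ht.1, ht.2.trans hx.2⟩
      · apply ContinuousOn.intervalIntegrable
        rw [uIcc_of_le hx.1]
        exact cy'.mono (Icc_subset_Icc_right hx.2)
    simp only [hY]
    rw [e1, e2]; ring
  refine ⟨fun x => (Y x : ℂ), fun x => (W x : ℂ), ⟨?_, ?_, ?_, ?_⟩, ?_, ?_⟩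
  · simp [hY]
  · exact Complex.continuous_ofReal.comp cW
  · intro x
    have : HasDerivAt Y (W x) x := by
      have := intervalIntegral.integral_hasDerivAt_right (cW.intervalIntegrable 0 x)
        cW.stronglyMeasurable.stronglyMeasurableAtFilter cW.continuousAt
      simpa [hY] using this.const_add (y 0)
    exact this.ofReal_comp
  · intro x hx
    have : ∫ t in (0:ℝ)..x, (((q t - c0 : ℝ) : ℂ) - ((lam - c0 : ℝ) : ℂ)) * (Y t : ℂ) 
        = ((∫ t in (0:ℝ)..x, (q t - lam) * y t : ℝ) : ℂ) := by
      rw [← intervalIntegral.integral_ofReal]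
      apply intervalIntegral.integral_congr
      intro t ht
      rw [uIcc_of_le hx.1] at ht
      simp only
      rw [Ye t ⟨ht.1, ht.2.trans hx.2⟩]
      push_cast; ring
    rw [this, We x hx, h.2 x hx]; push_cast; rfl
  · intro x hx; simp only [Ye x hx]
  · simp only; rw [We π pi_mem]

lemma CSol.smul {p : ℝ → ℂ} {lam a b : ℂ} {U V : ℝ → ℂ} (c : ℂ) (h : CSol p lam a b U V) :
    CSol p lam (c * a) (c * b) (fun t => c * U t) (fun t => c * V t) := by
  refine ⟨by simp [h.U0], continuous_const.mul h.cV, fun x => (h.dU x).const_mul c, ?_⟩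
  intro x hx
  rw [h.V_eq x hx, mul_add, ← intervalIntegral.integral_const_mul]
  congr 2; ext t; ring

/-- the characteristic function as an entire function, with all properties needed -/
theorem char_fun {q : ℝ → ℝ} (hq : IntervalIntegrable q volume 0 π) (c0 : ℝ)
    {α β : ℝ} (hα : α ∈ Ioo 0 π) (hβ : β ∈ Ioo 0 π) (φ φ' : ℝ → ℝ → ℝ) 
    (hsol : ∀ lam : ℝ, IsSol q lam (φ lam) (φ' lam))
    (h0 : ∀ lam : ℝ, φ lam 0 = Real.sin α)
    (h0' : ∀ lam : ℝ, φ' lam 0 = -Real.cos α) :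
    ∃ F : ℂ → ℂ, Differentiable ℂ F ∧ 
      (∀ lam : ℝ, F ((lam - c0 : ℝ) : ℂ) = ((φ lam π * Real.cos β + φ' lam π * Real.sin β : ℝ) : ℂ)) ∧
      (∀ z, F z = 0 → ∃ x : ℝ, z = x) ∧
      (∀ z, F z = 0 → deriv F z ≠ 0) ∧
      (∀ lam : ℝ, F ((lam - c0 : ℝ) : ℂ) = 0 ↔ IsEigenvalue q α β lam) ∧
      (∃ C s0 : ℝ, 0 < C ∧ 1 ≤ s0 ∧ ∀ s : ℂ, s0 ≤ ‖s‖ → 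
        ‖F (s^2) + ((Real.sin α * Real.sin β : ℝ) : ℂ) * s * Complex.sin (s * π)‖ ≤ C * Real.exp (|s.im| * π)) := by
  have sα : Real.sin α ≠ 0 := (Real.sin_pos_of_mem_Ioo hα).ne'
  have sβ : Real.sin β ≠ 0 := (Real.sin_pos_of_mem_Ioo hβ).ne'
  have hp : IntervalIntegrable (fun t => ((q t - c0 : ℝ) : ℂ)) volume 0 π := by
    have : IntervalIntegrable (fun t => q t - c0) volume 0 π := hq.sub (by simp)
    exact ⟨this.1.ofReal, this.2.ofReal⟩
  obtain ⟨U, V, hC, dU, dV, hcont, huniq⟩ := main_family (fun t => ((q t - c0 : ℝ) : ℂ)) hp 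
    ((Real.sin α : ℝ) : ℂ) ((-Real.cos α : ℝ) : ℂ)
  have dF : Differentiable ℂ fun lam => ((Real.cos β : ℝ) : ℂ) * U lam π + ((Real.sin β : ℝ) : ℂ) * V lam π :=
    (dU.const_mul _).add (dV.const_mul _)
  have hreal : ∀ lam : ℝ, U ((lam - c0 : ℝ) : ℂ) π = φ lam π ∧ V ((lam - c0 : ℝ) : ℂ) π = φ' lam π := by
    intro lam
    obtain ⟨U', V', h1, h2, h3⟩ := real_CSol hq c0 (hsol lam)
    rw [h0, h0'] at h1
    obtain ⟨g1, g2⟩ := huniq _ U' V' h1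
    exact ⟨by rw [← g1 π pi_mem, h2 π pi_mem], by rw [← g2, h3]⟩
  have hF : ∀ lam : ℝ, ((Real.cos β : ℝ) : ℂ) * U ((lam - c0 : ℝ) : ℂ) π + ((Real.sin β : ℝ) : ℂ) * V ((lam - c0 : ℝ) : ℂ) π 
      = ((φ lam π * Real.cos β + φ' lam π * Real.sin β : ℝ) : ℂ) := by
    intro lam
    rw [(hreal lam).1, (hreal lam).2]; push_cast; ring
  refine ⟨_, dF, hF, ?_, ?_, ?_, ?_⟩
  · intro z hz
    have := zero_real (p := fun t => q t - c0) hp (hC z) sα sβ hz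
    exact ⟨z.re, (Complex.conj_eq_iff_re.1 this).symm⟩
  · intro z hz
    exact zero_simple (p := fun t => q t - c0) hp hC sα sβ dF hcont hz
  · intro lam
    simp only [hF]
    constructor
    · intro hz
      refine ⟨φ lam, φ' lam, hsol lam, ⟨0, ⟨le_rfl, pi_pos.le⟩, by rw [h0]; exact sα⟩, ?_, ?_⟩
      · rw [h0, h0']; ring
      · exact_mod_cast hz
    · rintro ⟨y, y', hy, ⟨x, hx, hyx⟩, b0, bπ⟩
      obtain ⟨U', V', h1, h2, h3⟩ := real_CSol hq c0 hy
      set c := y 0 / Real.sin α with hc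
      have y0 : y 0 = c * Real.sin α := by rw [hc]; field_simp
      have y0' : y' 0 = c * -Real.cos α := by
        rw [y0] at b0
        apply mul_right_cancel₀ sα
        linear_combination b0
      obtain ⟨U1, V1, hC1, _, _, _, huniq1⟩ := main_family (fun t => ((q t - c0 : ℝ) : ℂ)) hp 
        (y 0 : ℂ) (y' 0 : ℂ)
      have k1 := huniq1 _ U' V' h1
      have h4 := (hC ((lam - c0 : ℝ) : ℂ)).smul (c : ℂ)
      rw [← Complex.ofReal_mul, ← Complex.ofReal_mul, ← y0, ← y0'] at h4
      have k2 := huniq1 _ _ _ h4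
      have hUx : ∀ x ∈ Icc (0:ℝ) π, (y x : ℂ) = c * U ((lam - c0 : ℝ) : ℂ) x := by
        intro x hx
        rw [← h2 x hx, k1.1 x hx, ← k2.1 x hx]
      have hVx : (y' π : ℂ) = c * V ((lam - c0 : ℝ) : ℂ) π := by
        rw [← h3, k1.2, ← k2.2]
      have cne : (c : ℂ) ≠ 0 := by
        intro hc0
        have := hUx x hx
        rw [hc0, zero_mul] at this
        exact hyx (by exact_mod_cast this)
      have e : (((y π * Real.cos β + y' π * Real.sin β : ℝ)) : ℂ) = 0 := by rw [bπ]; simp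
      rw [← hF]
      apply mul_left_cancel₀ cne
      rw [mul_zero, ← e, Complex.ofReal_add, Complex.ofReal_mul, Complex.ofReal_mul (y' π),
        hUx π pi_mem, hVx]
      ring
  · obtain ⟨C, s0, hC0, hs0, H⟩ := asymp hp ((Real.sin α : ℝ) : ℂ) ((-Real.cos α : ℝ) : ℂ) 
      ((Real.cos β : ℝ) : ℂ) ((Real.sin β : ℝ) : ℂ)
    refine ⟨C, s0, hC0, hs0, fun s hs => ?_⟩
    have := H s hs _ _ (hC (s^2))
    simpa using this

theorem F0_exists : ∃ F : ℂ → ℂ, Differentiable ℂ F ∧ 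
    (∀ s, F (s^2) = - s * Complex.sin (s * π)) ∧ (∀ z, F z = 0 → deriv F z ≠ 0) := by
  have hp : IntervalIntegrable (fun t : ℝ => (((fun _ => 0 : ℝ → ℝ) t : ℝ) : ℂ)) volume 0 π := by simp
  obtain ⟨U, V, hC, dU, dV, hcont, huniq⟩ := main_family (fun t : ℝ => (((fun _ => 0 : ℝ → ℝ) t : ℝ) : ℂ)) hp 
    ((1 : ℝ) : ℂ) ((0 : ℝ) : ℂ)
  have dF : Differentiable ℂ fun lam => ((0 : ℝ) : ℂ) * U lam π + ((1 : ℝ) : ℂ) * V lam π :=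
    (dU.const_mul _).add (dV.const_mul _)
  refine ⟨_, dF, ?_, ?_⟩
  · intro s
    have := voc' hp (hC (s^2)) π pi_mem
    simp at this ⊢
    rw [this]
  · intro z hz
    exact zero_simple (p := fun _ => 0) hp hC one_ne_zero one_ne_zero dF hcont hz



lemma jensen_count {F : ℂ → ℂ} (hF : Differentiable ℂ F) {ν : ℕ → ℝ} (hm : StrictMono ν) (ν0 : ν 0 = 0)
    (hz : ∀ z, F z = 0 ↔ ∃ k, z = (ν k : ℂ)) (hs : ∀ z, F z = 0 → deriv F z ≠ 0)
    {R : ℝ} (hR : 0 < R) (m : ℕ) (hc : ∀ k, ν k ≤ R ↔ k ≤ m) :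
    circleAverage (fun z => Real.log ‖F z‖) 0 R = 
      ∑ k ∈ Finset.range m, Real.log (R / ν (k + 1)) + Real.log R + Real.log ‖deriv F 0‖ := by
  have hA : AnalyticOnNhd ℂ F (Metric.closedBall 0 |R|) := fun z _ => hF.analyticAt z
  have F0 : F 0 = 0 := (hz 0).2 ⟨0, by simp [ν0]⟩
  have hν : ∀ k, 0 ≤ ν k := fun k => by rw [← ν0]; exact hm.monotone (Nat.zero_le k)
  have J := MeromorphicOn.circleAverage_log_norm (c := 0) hR.ne' hA.meromorphicOn
  have hd1 : ∀ k, k ≤ m → MeromorphicOn.divisor F (Metric.closedBall 0 |R|) (ν k : ℂ) = 1 := by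
    intro k hk
    have hmem : (ν k : ℂ) ∈ Metric.closedBall (0:ℂ) |R| := by
      simp [abs_of_nonneg (hν k), abs_of_pos hR, (hc k).2 hk]
    rw [MeromorphicOn.AnalyticOnNhd.divisor_apply hA hmem, 
      (hF.analyticAt _).analyticOrderAt_eq_one_of_zero_deriv_ne_zero ((hz _).2 ⟨k, rfl⟩) (hs _ ((hz _).2 ⟨k, rfl⟩))]
    rfl
  have hd0 : ∀ u, (¬ ∃ k, k ≤ m ∧ (ν k : ℂ) = u) → MeromorphicOn.divisor F (Metric.closedBall 0 |R|) u = 0 := by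
    intro u hu
    by_cases hmem : u ∈ Metric.closedBall (0:ℂ) |R|
    · rw [MeromorphicOn.AnalyticOnNhd.divisor_apply hA hmem]
      have : F u ≠ 0 := by
        intro h
        obtain ⟨k, hk⟩ := (hz u).1 h
        refine hu ⟨k, ?_, hk.symm⟩
        rw [← hc k]
        rw [hk] at hmem
        simpa [abs_of_nonneg (hν k), abs_of_pos hR] using hmem
      rw [(hF.analyticAt u).analyticOrderAt_eq_zero.2 this]
      rfl
    · exact Function.locallyFinsuppWithin.apply_eq_zero_of_notMem _ hmem
  have htr : meromorphicTrailingCoeffAt F 0 = deriv F 0 := by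
    have hA0 : AnalyticAt ℂ (dslope F 0) 0 := by
      have : DifferentiableOn ℂ (dslope F 0) univ := 
        (Complex.differentiableOn_dslope Filter.univ_mem).2 hF.differentiableOn
      exact this.analyticAt Filter.univ_mem
    rw [hA0.meromorphicTrailingCoeffAt_of_ne_zero_of_eq_nhdsNE (n := 1)]
    · simp
    · simpa using hs 0 F0
    · filter_upwards with z
      have := sub_smul_dslope F 0 z
      simp [F0] at this ⊢
      exact this.symm
  have hd00 := hd1 0 (Nat.zero_le m)
  rw [ν0] at hd00
  rw [J, htr]
  rw [Complex.ofReal_zero] at hd00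
  rw [hd00]
  simp only [Int.cast_one, one_mul]
  congr 2
  rw [finsum_eq_sum_of_support_subset (s := (Finset.range (m+1)).image (fun k => (ν k : ℂ)))]
  · rw [Finset.sum_image]
    · rw [Finset.sum_range_succ']
      simp only [ν0]
      simp only [Complex.ofReal_zero, sub_self, norm_zero, inv_zero, mul_zero, Real.log_zero, add_zero]
      apply Finset.sum_congr rfl
      intro k hk
      rw [hd1 (k+1) (by simpa using hk)]
      simp [abs_of_nonneg (hν _), div_eq_mul_inv]
    · intro i _ j _ hij
      exact hm.injective (by simpa using hij)
  · intro u hu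
    by_contra hcon
    apply hu
    have := hd0 u (by
      rintro ⟨k, hk, e⟩
      apply hcon
      simp only [Finset.coe_image, Finset.coe_range, Set.mem_image, Set.mem_Iio]
      exact ⟨k, by omega, e⟩)
    simp only [this]; simp

lemma avg_close {F G : ℂ → ℂ} (hF : Differentiable ℂ F) (hG : Differentiable ℂ G) (R l ε : ℝ)
    (h : ∀ z ∈ Metric.sphere (0:ℂ) |R|, |Real.log ‖F z‖ - Real.log ‖G z‖ - l| ≤ ε) :
    |circleAverage (fun z => Real.log ‖F z‖) 0 R - circleAverage (fun z => Real.log ‖G z‖) 0 R - l| ≤ ε := by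
  have hA : MeromorphicOn F (Metric.sphere 0 |R|) := fun z _ => (hF.analyticAt z).meromorphicAt
  have hB : MeromorphicOn G (Metric.sphere 0 |R|) := fun z _ => (hG.analyticAt z).meromorphicAt
  have iA : CircleIntegrable (fun z => Real.log ‖F z‖) 0 R := MeromorphicOn.circleIntegrable_log_norm hA
  have iB : CircleIntegrable (fun z => Real.log ‖G z‖) 0 R := MeromorphicOn.circleIntegrable_log_norm hB
  have i1 : ∀ t : ℝ, CircleIntegrable (fun _ => t) 0 R := fun t => circleIntegrable_const t 0 R
  have e : ∀ t : ℝ, circleAverage (fun z => Real.log ‖G z‖ + t) 0 R = 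
      circleAverage (fun z => Real.log ‖G z‖) 0 R + t := by
    intro t
    rw [circleAverage_fun_add iB (i1 t), circleAverage_const]
  have u := circleAverage_mono iA (iB.add (i1 (l + ε))) (fun z hz => by
    have := (abs_le.1 (h z hz)).2
    simp only [Pi.add_apply]; linarith)
  have lo := circleAverage_mono (iB.add (i1 (l - ε))) iA (fun z hz => by
    have := (abs_le.1 (h z hz)).1
    simp only [Pi.add_apply]; linarith)
  have u' : circleAverage (fun z => Real.log ‖F z‖) 0 R ≤ _ := u.trans_eq (e (l+ε))
  have lo' := (e (l-ε)).symm.trans_le lo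
  rw [abs_le]; constructor <;> linarith



lemma sin_lower (N : ℕ) (hN : 1 ≤ N) (s : ℂ) (hs : ‖s‖ = N + 1/2) :
    Real.exp (|s.im| * π) ≤ 18 * ‖Complex.sin (s * π)‖ := by
  by_cases hi : 1/2 ≤ |s.im|
  · have h1 : Complex.sin (s * π) = (Complex.exp (-(s*π) * Complex.I) - Complex.exp ((s * π) * Complex.I)) * Complex.I / 2 := rfl
    have n1 : ‖Complex.exp (-(s*π) * Complex.I)‖ = Real.exp (s.im * π) := by
      rw [Complex.norm_exp]; simp
    have n2 : ‖Complex.exp ((s*π) * Complex.I)‖ = Real.exp (-(s.im * π)) := by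
      rw [Complex.norm_exp]; simp
    have h2 := abs_norm_sub_norm_le (Complex.exp (-(s*π) * Complex.I)) (Complex.exp ((s*π) * Complex.I))
    rw [n1, n2] at h2
    have h3 : ‖Complex.sin (s * π)‖ = ‖Complex.exp (-(s*π) * Complex.I) - Complex.exp ((s * π) * Complex.I)‖ / 2 := by
      rw [h1]; simp
    have h4 : Real.exp (|s.im| * π) - Real.exp (-(|s.im| * π)) ≤ |Real.exp (s.im * π) - Real.exp (-(s.im * π))| := by
      rcases abs_cases s.im with ⟨e, _⟩ | ⟨e, _⟩
      · rw [e]; exact le_abs_self _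
      · rw [e, abs_sub_comm]; 
        have := le_abs_self (Real.exp (-(s.im * π)) - Real.exp (s.im * π))
        simpa using this
    have h5 : (1:ℝ) ≤ |s.im| * π := by nlinarith [pi_gt_three]
    have h6 : Real.exp (-(|s.im| * π)) ≤ Real.exp (-1) := Real.exp_le_exp.2 (by linarith)
    have h7 : Real.exp 1 ≤ Real.exp (|s.im| * π) := Real.exp_le_exp.2 h5
    have h8 : Real.exp (-1) < 0.37 := by linarith [Real.exp_neg_one_lt_d9]
    have h9 : 2.7 < Real.exp 1 := by linarith [Real.exp_one_gt_d9]
    rw [h3]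
    linarith
  · push Not at hi
    have hsq : s.re^2 + s.im^2 = (N+1/2:ℝ)^2 := by
      rw [← hs, Complex.sq_norm, Complex.normSq_apply]; ring
    have hN' : (1:ℝ) ≤ N := by exact_mod_cast hN
    have him : s.im^2 ≤ 1/4 := by
      rw [← sq_abs]; nlinarith [abs_nonneg s.im]
    set r := |s.re| with hr
    have r0 : 0 ≤ r := abs_nonneg _
    have hrsq : r^2 = s.re^2 := sq_abs _
    have hr1 : r ≤ N + 1/2 := by nlinarith [sq_nonneg s.im]
    have hr2 : (N:ℝ) + 1/2 - 1/6 ≤ r := by nlinarith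
    have hsin : 1/2 ≤ |Real.sin (s.re * π)| := by
      have e1 : |Real.sin (s.re * π)| = |Real.sin (r * π)| := by
        rcases abs_cases s.re with ⟨e, _⟩ | ⟨e, _⟩
        · rw [hr, e]
        · rw [hr, e, neg_mul, Real.sin_neg, abs_neg]
      have e2 : |Real.sin (r * π)| = |Real.cos ((N + 1/2 - r) * π)| := by
        have : r * π = (N * π + π/2) - (N+1/2-r) * π := by ring
        rw [this, Real.sin_sub, Real.sin_add_pi_div_two, Real.cos_add_pi_div_two, Real.sin_nat_mul_pi,
          Real.cos_nat_mul_pi]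
        simp [abs_mul]
      rw [e1, e2]
      have := Real.cos_le_cos_of_nonneg_of_le_pi (x := (N + 1/2 - r) * π) (y := π/3) 
        (mul_nonneg (by linarith) pi_pos.le) (by linarith [pi_pos]) (by nlinarith [pi_pos])
      rw [Real.cos_pi_div_three] at this
      exact this.trans (le_abs_self _)
    have hre : |Real.sin (s.re * π)| ≤ ‖Complex.sin (s * π)‖ := by
      have h1 := Complex.abs_re_le_norm (Complex.sin (s * π))
      have h2 : (Complex.sin (s * π)).re = Real.sin (s.re * π) * Real.cosh (s.im * π) := by
        have := Complex.sin_eq (s * π)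
        have e1 : (s * (π:ℂ)).re = s.re * π := by simp
        have e2 : (s * (π:ℂ)).im = s.im * π := by simp
        rw [e1, e2, ← Complex.ofReal_sin, ← Complex.ofReal_cos, ← Complex.ofReal_cosh, ← Complex.ofReal_sinh] at this
        rw [this]
        simp [← Complex.ofReal_sin, ← Complex.ofReal_cos, ← Complex.ofReal_cosh, ← Complex.ofReal_sinh, -Complex.ofReal_mul]
      rw [h2, abs_mul, abs_of_pos (Real.cosh_pos _)] at h1
      nlinarith [Real.one_le_cosh (s.im * π), abs_nonneg (Real.sin (s.re * π))]
    have hexp : Real.exp (|s.im| * π) ≤ 9 := by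
      have : |s.im| * π ≤ 2 := by nlinarith [pi_lt_four, pi_pos]
      have h2 : Real.exp 2 = Real.exp 1 * Real.exp 1 := by rw [← Real.exp_add]; norm_num
      have h3 := Real.exp_one_lt_d9
      have h4 := Real.exp_le_exp.2 this
      nlinarith [Real.exp_pos 1]
    linarith

lemma log_close (w : ℂ) (r : ℝ) (hw : ‖w‖ ≤ r) (hr : r ≤ 1/2) : |Real.log ‖1 + w‖| ≤ 2 * r := by
  have h1 : ‖1 + w‖ ≤ 1 + r := by
    have := norm_add_le (1:ℂ) w
    simp at this; linarith
  have h2 : 1 - r ≤ ‖1 + w‖ := by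
    have := norm_sub_norm_le (1:ℂ) (-w)
    simp at this; linarith
  have h0 : 0 ≤ r := (norm_nonneg _).trans hw
  have hp : 0 < ‖1 + w‖ := by linarith
  rw [abs_le]
  constructor
  · have := Real.one_sub_inv_le_log_of_pos hp
    have h3 : ‖1+w‖⁻¹ ≤ 1 + 2 * r := by
      rw [inv_le_iff_one_le_mul₀ hp]
      nlinarith
    linarith
  · have := Real.log_le_sub_one_of_pos hp
    linarith

lemma exists_sqrt (z : ℂ) : ∃ s : ℂ, s^2 = z := IsAlgClosed.exists_pow_nat_eq z (by norm_num)

lemma F0_zero {F : ℂ → ℂ} (h : ∀ s, F (s^2) = - s * Complex.sin (s * π)) (z : ℂ) :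
    F z = 0 ↔ ∃ k : ℕ, z = (((k:ℝ)^2 : ℝ) : ℂ) := by
  have hpi : (π : ℂ) ≠ 0 := by exact_mod_cast pi_ne_zero
  constructor
  · intro hz
    obtain ⟨s, rfl⟩ := exists_sqrt z
    rw [h] at hz
    rcases mul_eq_zero.1 hz with hs | hs
    · exact ⟨0, by simpa using hs⟩
    · obtain ⟨k, hk⟩ := Complex.sin_eq_zero_iff.1 hs
      have : s = k := mul_right_cancel₀ hpi hk
      refine ⟨k.natAbs, ?_⟩
      rw [this, Nat.cast_natAbs]
      push_cast
      norm_cast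
      simp
  · rintro ⟨k, rfl⟩
    push_cast
    rw [h, Complex.sin_nat_mul_pi]; simp

lemma F0_deriv {F : ℂ → ℂ} (hF : Differentiable ℂ F) (h : ∀ s, F (s^2) = - s * Complex.sin (s * π)) :
    deriv F 0 = -π := by
  have F0 : F 0 = 0 := by simpa using h 0
  have d1 := (hF 0).hasDerivAt
  rw [hasDerivAt_iff_tendsto_slope] at d1
  have t : Filter.Tendsto (fun s : ℂ => s^2) (nhdsWithin 0 {0}ᶜ) (nhdsWithin 0 {0}ᶜ) := by
    apply tendsto_nhdsWithin_of_tendsto_nhds_of_eventually_within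
    · have : Continuous fun s : ℂ => s^2 := by fun_prop
      simpa using (this.tendsto 0).mono_left nhdsWithin_le_nhds
    · filter_upwards [self_mem_nhdsWithin] with s hs
      simpa using hs
  have d2 := d1.comp t
  have d3 : HasDerivAt (fun s : ℂ => - Complex.sin (s * π)) (-π) 0 := by
    have := ((hasDerivAt_id (0:ℂ)).mul_const (π:ℂ)).csin.neg
    simpa using! this
  rw [hasDerivAt_iff_tendsto_slope] at d3
  refine tendsto_nhds_unique d2 (d3.congr' ?_)
  filter_upwards [self_mem_nhdsWithin] with s hs
  have hs' : s ≠ 0 := by simpa using hs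
  simp only [Function.comp, slope_def_field, h, F0]
  simp; field_simp

theorem tendsto_avg {F G : ℂ → ℂ} (hF : Differentiable ℂ F) (hG : Differentiable ℂ G) {A : ℝ} (hA : 0 < A)
    (hGs : ∀ s, G (s^2) = - s * Complex.sin (s * π)) 
    (has : ∃ C s0 : ℝ, 0 < C ∧ 1 ≤ s0 ∧ ∀ s : ℂ, s0 ≤ ‖s‖ → 
        ‖F (s^2) + (A : ℂ) * s * Complex.sin (s * π)‖ ≤ C * Real.exp (|s.im| * π)) :
    Filter.Tendsto (fun N : ℕ => circleAverage (fun z => Real.log ‖F z‖) 0 ((N+1/2:ℝ)^2) - 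
      circleAverage (fun z => Real.log ‖G z‖) 0 ((N+1/2:ℝ)^2)) Filter.atTop (nhds (Real.log A)) := by
  obtain ⟨C, s0, hC, hs0, H⟩ := has
  set K := 18 * C / A with hK
  have K0 : 0 < K := by positivity
  have tN : Filter.Tendsto (fun N : ℕ => (N + 1/2 : ℝ)) Filter.atTop Filter.atTop :=
    Filter.tendsto_atTop_add_const_right _ _ tendsto_natCast_atTop_atTop
  have key : ∀ᶠ N : ℕ in Filter.atTop, |circleAverage (fun z => Real.log ‖F z‖) 0 ((N+1/2:ℝ)^2) - 
      circleAverage (fun z => Real.log ‖G z‖) 0 ((N+1/2:ℝ)^2) - Real.log A| ≤ 2 * (K / (N + 1/2)) := by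
    filter_upwards [tN.eventually_ge_atTop s0, tN.eventually_ge_atTop (2 * K), Filter.eventually_ge_atTop 1] 
      with N h1 h2 h3
    have hpos : (0:ℝ) < N + 1/2 := by positivity
    apply avg_close hF hG
    intro z hz
    obtain ⟨s, rfl⟩ := exists_sqrt z
    have hs : ‖s‖ = N + 1/2 := by
      simp only [mem_sphere_iff_norm, sub_zero, norm_pow, abs_pow, abs_of_pos hpos] at hz
      exact (pow_left_inj₀ (norm_nonneg _) hpos.le two_ne_zero).1 hz
    have hE := H s (by rw [hs]; exact h1)
    have hL := sin_lower N h3 s hs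
    have hsin : 0 < ‖Complex.sin (s * π)‖ := by
      have := Real.exp_pos (|s.im| * π); linarith
    have sinne : Complex.sin (s * π) ≠ 0 := norm_pos_iff.1 hsin
    have sne : s ≠ 0 := by rw [← norm_pos_iff, hs]; exact hpos
    have Ane : (A:ℂ) ≠ 0 := by exact_mod_cast hA.ne'
    set E := F (s^2) + (A : ℂ) * s * Complex.sin (s * π) with hEdef
    set w := - E / (A * s * Complex.sin (s * π)) with hw
    have hFw : F (s^2) = A * G (s^2) * (1 + w) := by
      rw [hGs, hw]; field_simp; rw [hEdef]; ring
    have hwn : ‖w‖ ≤ K / (N+1/2) := by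
      rw [hw, norm_div, norm_neg, norm_mul, norm_mul, hs, Complex.norm_real, Real.norm_of_nonneg hA.le]
      rw [div_le_div_iff₀ (by positivity) hpos, hK]
      have : ‖E‖ ≤ C * (18 * ‖Complex.sin (s * π)‖) := hE.trans (by gcongr)
      calc ‖E‖ * (N+1/2:ℝ) ≤ C * (18 * ‖Complex.sin (s * π)‖) * (N + 1/2) := by gcongr
        _ = _ := by field_simp
    have hK2 : K / (N + 1/2 : ℝ) ≤ 1/2 := by
      rw [div_le_div_iff₀ hpos (by norm_num)]; linarith
    have hlog := log_close w _ hwn hK2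
    have w1 : ‖1 + w‖ ≠ 0 := by
      have := norm_sub_norm_le (1:ℂ) (-w)
      simp at this
      intro h; rw [h] at this; linarith
    have Gne : ‖G (s^2)‖ ≠ 0 := by
      rw [hGs]; simp [sne, sinne]
    have : Real.log ‖F (s^2)‖ - Real.log ‖G (s^2)‖ - Real.log A = Real.log ‖1 + w‖ := by
      rw [hFw, norm_mul, norm_mul, Complex.norm_real, Real.norm_of_nonneg hA.le, 
        Real.log_mul (mul_ne_zero hA.ne' Gne) w1, Real.log_mul hA.ne' Gne]; ring
    rw [this]; exact hlog
  rw [tendsto_iff_norm_sub_tendsto_zero]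
  apply squeeze_zero' (Filter.Eventually.of_forall fun _ => norm_nonneg _) key
  have := (Filter.Tendsto.const_div_atTop tN K).const_mul 2
  simpa using this

theorem J_limit {F : ℂ → ℂ} (hF : Differentiable ℂ F) {ν : ℕ → ℝ} (hm : StrictMono ν) (ν0 : ν 0 = 0)
    (hz : ∀ z, F z = 0 ↔ ∃ k, z = (ν k : ℂ)) (hs : ∀ z, F z = 0 → deriv F z ≠ 0)
    {A : ℝ} (hA : 0 < A)
    (has : ∃ C s0 : ℝ, 0 < C ∧ 1 ≤ s0 ∧ ∀ s : ℂ, s0 ≤ ‖s‖ → 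
        ‖F (s^2) + (A : ℂ) * s * Complex.sin (s * π)‖ ≤ C * Real.exp (|s.im| * π))
    (m : ℕ → ℕ) (hc : ∀ N k : ℕ, ν k ≤ (N+1/2:ℝ)^2 ↔ k ≤ m N) :
    Filter.Tendsto (fun N : ℕ => ∑ k ∈ Finset.range (m N), Real.log ((N+1/2:ℝ)^2 / ν (k + 1)) - 
      ∑ k ∈ Finset.range N, Real.log ((N+1/2:ℝ)^2 / ((k:ℝ)+1)^2)) Filter.atTop 
      (nhds (Real.log A + Real.log π - Real.log ‖deriv F 0‖)) := by
  obtain ⟨G, hG, hGs, hGd⟩ := F0_exists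
  have T := tendsto_avg hF hG hA hGs has
  have T2 := (T.add_const (Real.log π)).sub_const (Real.log ‖deriv F 0‖)
  refine T2.congr fun N => ?_
  have hpos : (0:ℝ) < (N + 1/2)^2 := by positivity
  rw [jensen_count hF hm ν0 hz hs hpos (m N) (hc N)]
  have hm0 : StrictMono (fun k : ℕ => (k:ℝ)^2) := by
    intro i j hij
    have : (i:ℝ) < j := by exact_mod_cast hij
    simp only
    gcongr
  rw [jensen_count (ν := fun k : ℕ => (k:ℝ)^2) hG hm0 (by simp) (F0_zero hGs) hGd hpos N ?_]
  · rw [F0_deriv hG hGs]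
    simp only [norm_neg, Complex.norm_real, Real.norm_of_nonneg pi_pos.le]
    push_cast
    ring
  · intro k
    constructor
    · intro h
      have h1 : (k:ℝ) ≤ N + 1/2 := le_of_sq_le_sq h (by positivity)
      by_contra hk
      have : (N:ℝ) + 1 ≤ k := by exact_mod_cast (not_le.1 hk)
      linarith
    · intro h
      have : (k:ℝ) ≤ N := by exact_mod_cast h
      gcongr; linarith



lemma div_top (g : ℕ → ℝ) (K : ℕ) (h : ∀ k, K ≤ k → 1/2 * (1 / ((k:ℝ)+1)) ≤ g k) :
    Filter.Tendsto (fun n => ∑ k ∈ Finset.range n, g k) Filter.atTop Filter.atTop := by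
  set c := ∑ k ∈ Finset.range K, (g k - 1/2 * (1 / ((k:ℝ)+1)))
  have h1 : ∀ n, K ≤ n → c ≤ ∑ k ∈ Finset.range n, (g k - 1/2 * (1 / ((k:ℝ)+1))) := by
    intro n hn
    induction n, hn using Nat.le_induction with
    | base => exact le_rfl
    | succ n hn ih =>
      rw [Finset.sum_range_succ]
      linarith [h n hn]
  have T := Filter.tendsto_atTop_add_const_left Filter.atTop c
    (Real.tendsto_sum_range_one_div_nat_succ_atTop.const_mul_atTop (by norm_num : (0:ℝ) < 1/2))
  refine Filter.tendsto_atTop_mono' _ ?_ T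
  filter_upwards [Filter.eventually_ge_atTop K] with n hn
  have := h1 n hn
  rw [Finset.sum_sub_distrib, ← Finset.mul_sum] at this
  linarith

lemma ivt_zero {f : ℝ → ℝ} (hf : Continuous f) {a b : ℝ} (hab : a < b) (h : f a * f b < 0) :
    ∃ x ∈ Ioo a b, f x = 0 := by
  have h1 := intermediate_value_uIcc (f := f) (a := a) (b := b) hf.continuousOn
  have h2 : (0:ℝ) ∈ uIcc (f a) (f b) := by
    rw [mem_uIcc]
    rcases mul_neg_iff.1 h with h | h
    · right; exact ⟨h.2.le, h.1.le⟩
    · left; exact ⟨h.1.le, h.2.le⟩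
  obtain ⟨x, hx, e⟩ := h1 h2
  rw [uIcc_of_le hab.le] at hx
  refine ⟨x, ⟨lt_of_le_of_ne hx.1 ?_, lt_of_le_of_ne hx.2 ?_⟩, e⟩
  · rintro rfl; rw [e] at h; simp at h
  · rintro rfl; rw [e] at h; simp at h

theorem counting {ν : ℕ → ℝ} (hm : StrictMono ν) (ν0 : ν 0 = 0) (m : ℕ → ℕ) 
    (hc : ∀ N k : ℕ, ν k ≤ (N+1/2:ℝ)^2 ↔ k ≤ m N) (n0 : ℕ)
    (hz : ∀ N : ℕ, n0 ≤ N → ∃ k, (N+1/2:ℝ)^2 < ν k ∧ ν k ≤ (((N+1 : ℕ):ℝ)+1/2)^2) (L : ℝ)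
    (hL : Filter.Tendsto (fun N : ℕ => ∑ k ∈ Finset.range (m N), Real.log ((N+1/2:ℝ)^2 / ν (k + 1)) - 
      ∑ k ∈ Finset.range N, Real.log ((N+1/2:ℝ)^2 / ((k:ℝ)+1)^2)) Filter.atTop (nhds L)) :
    (∃ N1, ∀ N, N1 ≤ N → m N = N) ∧ 
    Filter.Tendsto (fun N : ℕ => ∑ k ∈ Finset.range N, Real.log (((k:ℝ)+1)^2 / ν (k+1))) 
      Filter.atTop (nhds L) := by
  have νpos : ∀ k, 0 < ν (k+1) := fun k => by rw [← ν0]; exact hm (Nat.succ_pos k)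
  have hstep : ∀ N, n0 ≤ N → m N + 1 ≤ m (N+1) := by
    intro N hN
    obtain ⟨k, h1, h2⟩ := hz N hN
    have a1 : ¬ k ≤ m N := by rw [← hc]; exact not_le.2 h1
    have a2 : k ≤ m (N+1) := by rw [← hc]; exact h2
    omega
  have hgrow : ∀ N M, n0 ≤ N → N ≤ M → m N + (M - N) ≤ m M := by
    intro N M hN hNM
    induction M, hNM using Nat.le_induction with
    | base => simp
    | succ M hM ih => have := hstep M (hN.trans hM); omega
  have hsplit : ∀ N k : ℕ, Real.log ((N+1/2:ℝ)^2 / ν (k + 1)) = 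
      Real.log (((k:ℝ)+1)^2 / ν (k+1)) + Real.log ((N+1/2:ℝ)^2 / ((k:ℝ)+1)^2) := by
    intro N k
    have h1 := (νpos k).ne'
    have h2 : ((k:ℝ)+1)^2 ≠ 0 := by positivity
    have h3 : (N+1/2:ℝ)^2 ≠ 0 := by positivity
    rw [Real.log_div h3 h1, Real.log_div h2 h1, Real.log_div h3 h2]; ring
  set S : ℕ → ℝ := fun n => ∑ k ∈ Finset.range n, Real.log (((k:ℝ)+1)^2 / ν (k+1)) with hS
  have hJ : ∀ N n : ℕ, ∑ k ∈ Finset.range n, Real.log ((N+1/2:ℝ)^2 / ν (k + 1)) = 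
      S n + ∑ k ∈ Finset.range n, Real.log ((N+1/2:ℝ)^2 / ((k:ℝ)+1)^2) := by
    intro N n
    rw [hS, ← Finset.sum_add_distrib]
    exact Finset.sum_congr rfl fun k _ => hsplit N k
  -- case A
  have notA : ∀ N, n0 ≤ N → m N ≤ N := by
    intro N1 hN1
    by_contra hcon
    have hA : ∀ N, N1 ≤ N → N + 1 ≤ m N := by
      intro N hN
      have := hgrow N1 N hN1 hN
      omega
    have T : Filter.Tendsto S Filter.atTop Filter.atTop := by
      apply div_top _ N1
      intro k hk
      have h1 : ν (k+1) ≤ (k+1/2:ℝ)^2 := (hc k (k+1)).2 (hA k hk)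
      have h2 : ((k:ℝ)+1)^2 / (k+1/2:ℝ)^2 ≤ ((k:ℝ)+1)^2 / ν (k+1) := by
        apply div_le_div_of_nonneg_left (by positivity) (νpos k) h1
      have h3 := Real.log_le_log (by positivity) h2
      have h4 := Real.one_sub_inv_le_log_of_pos (show 0 < ((k:ℝ)+1) / (k+1/2:ℝ) by positivity)
      rw [← div_pow, Real.log_pow] at h3
      have h5 : 1 - (((k:ℝ)+1) / (k+1/2:ℝ))⁻¹ = 1/2 * (1 / ((k:ℝ)+1)) := by
        field_simp; ring
      have h6 : 0 ≤ 1/2 * (1 / ((k:ℝ)+1)) := by positivity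
      push_cast at h3
      linarith
    have T2 := Filter.tendsto_atTop_mono' Filter.atTop (f₁ := S) (f₂ := fun N : ℕ => ∑ k ∈ Finset.range (m N), Real.log ((N+1/2:ℝ)^2 / ν (k + 1)) - 
      ∑ k ∈ Finset.range N, Real.log ((N+1/2:ℝ)^2 / ((k:ℝ)+1)^2)) ?_ T
    · exact not_tendsto_nhds_of_tendsto_atTop T2 _ hL
    · filter_upwards [Filter.eventually_ge_atTop N1] with N hN
      have h1 : ∑ k ∈ Finset.range N, Real.log ((N+1/2:ℝ)^2 / ν (k + 1)) ≤ 
          ∑ k ∈ Finset.range (m N), Real.log ((N+1/2:ℝ)^2 / ν (k + 1)) := by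
        apply Finset.sum_le_sum_of_subset_of_nonneg
        · apply Finset.range_subset_range.2; have := hA N hN; omega
        · intro k hk _
          apply Real.log_nonneg
          rw [one_le_div (νpos k), hc]
          have := Finset.mem_range.1 hk
          omega
      rw [hJ N N] at h1
      linarith
  have notB : ∃ N, n0 ≤ N ∧ N ≤ m N := by
    by_contra hcon
    push Not at hcon
    have T : Filter.Tendsto (fun n => ∑ k ∈ Finset.range n, -Real.log (((k:ℝ)+1)^2 / ν (k+1))) 
        Filter.atTop Filter.atTop := by
      apply div_top _ n0
      intro k hk
      have h1 : ((k:ℝ)+1+1/2)^2 ≤ ν (k+1) := by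
        have := hcon (k+1) (by omega)
        have h2 : ¬ ν (k+1) ≤ (((k+1:ℕ):ℝ)+1/2)^2 := by rw [hc]; omega
        push_cast at h2
        exact (not_le.1 h2).le
      have h2 : ((k:ℝ)+1)^2 / ν (k+1) ≤ ((k:ℝ)+1)^2 / ((k:ℝ)+1+1/2)^2 := by
        apply div_le_div_of_nonneg_left (by positivity) (by positivity) h1
      have h3 := Real.log_le_log (div_pos (by positivity) (νpos k)) h2
      have h4 := Real.log_le_sub_one_of_pos (show 0 < ((k:ℝ)+1) / ((k:ℝ)+1+1/2) by positivity)
      rw [← div_pow, Real.log_pow] at h3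
      have h5 : 1/2 * (1/2 * (1 / ((k:ℝ)+1))) ≤ 1 - ((k:ℝ)+1) / ((k:ℝ)+1+1/2) := by
        rw [show 1 - ((k:ℝ)+1) / ((k:ℝ)+1+1/2) = (1/2) * (1 / ((k:ℝ)+1+1/2)) by field_simp; ring]
        have : 1/2 * (1 / ((k:ℝ)+1)) ≤ 1 / ((k:ℝ)+1+1/2) := by
          rw [← div_eq_mul_one_div, div_div, div_le_div_iff₀ (by positivity) (by positivity)]
          have : (0:ℝ) ≤ k := by positivity
          linarith
        linarith
      push_cast at h3
      linarith
    have hmtop : Filter.Tendsto m Filter.atTop Filter.atTop := by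
      rw [Filter.tendsto_atTop_atTop]
      intro b
      refine ⟨n0 + b, fun a ha => ?_⟩
      have := hgrow n0 a le_rfl (by omega)
      omega
    have T1 := T.comp hmtop
    have T2 := Filter.tendsto_atTop_mono' Filter.atTop (f₂ := fun N : ℕ => -(∑ k ∈ Finset.range (m N), Real.log ((N+1/2:ℝ)^2 / ν (k + 1)) - 
      ∑ k ∈ Finset.range N, Real.log ((N+1/2:ℝ)^2 / ((k:ℝ)+1)^2))) ?_ T1
    · exact not_tendsto_nhds_of_tendsto_atTop T2 _ hL.neg
    · filter_upwards [Filter.eventually_ge_atTop n0] with N hN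
      simp only [Function.comp, Finset.sum_neg_distrib]
      rw [hJ]
      have h1 : ∑ k ∈ Finset.range (m N), Real.log ((N+1/2:ℝ)^2 / ((k:ℝ)+1)^2) ≤ 
         ∑ k ∈ Finset.range N, Real.log ((N+1/2:ℝ)^2 / ((k:ℝ)+1)^2) := by
        apply Finset.sum_le_sum_of_subset_of_nonneg
        · apply Finset.range_subset_range.2; have := hcon N hN; omega
        · intro k hk _
          apply Real.log_nonneg
          rw [one_le_div (by positivity)]
          have : (k:ℝ) + 1 ≤ N := by exact_mod_cast Finset.mem_range.1 hk
          exact pow_le_pow_left₀ (by positivity) (by linarith) 2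
      simp only [hS]
      linarith
  obtain ⟨N1, hN1, hN1'⟩ := notB
  have hmN : ∀ N, N1 ≤ N → m N = N := by
    intro N hN
    have h1 := hgrow N1 N hN1 hN
    have h2 := notA N (hN1.trans hN)
    omega
  refine ⟨⟨N1, hmN⟩, hL.congr' ?_⟩
  filter_upwards [Filter.eventually_ge_atTop N1] with N hN
  rw [hmN N hN, hJ]; simp only [hS]; ring



lemma real_asymp {F : ℂ → ℂ} {f : ℝ → ℝ} (hf : ∀ x : ℝ, F x = f x) {A C s0 : ℝ} (hs0 : 1 ≤ s0)
    (has : ∀ s : ℂ, s0 ≤ ‖s‖ → 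
        ‖F (s^2) + (A : ℂ) * s * Complex.sin (s * π)‖ ≤ C * Real.exp (|s.im| * π))
    (t : ℝ) (ht : s0 ≤ t) : |f (t^2) + A * t * Real.sin (t * π)| ≤ C := by
  have h := has (t : ℂ) (by rw [Complex.norm_real, Real.norm_of_nonneg (by linarith)]; exact ht)
  rw [← Complex.ofReal_pow, hf, ← Complex.ofReal_mul, ← Complex.ofReal_mul, ← Complex.ofReal_sin, 
    ← Complex.ofReal_mul, ← Complex.ofReal_add, Complex.norm_real] at h
  simpa using h

lemma sin_half (n : ℕ) : Real.sin ((n + 1/2 : ℝ) * π) = (-1)^n := by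
  rw [show (n + 1/2 : ℝ) * π = n * π + π/2 by ring, Real.sin_add_pi_div_two, Real.cos_nat_mul_pi]

lemma neg_asymp {F : ℂ → ℂ} {f : ℝ → ℝ} (hf : ∀ x : ℝ, F x = f x) {A C s0 : ℝ} (hA : 0 < A) (hC : 0 < C) (hs0 : 1 ≤ s0)
    (has : ∀ s : ℂ, s0 ≤ ‖s‖ → 
        ‖F (s^2) + (A : ℂ) * s * Complex.sin (s * π)‖ ≤ C * Real.exp (|s.im| * π))
    (t : ℝ) (ht : s0 ≤ t) (ht2 : 4 * C < A * t) : 0 < f (-t^2) := by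
  have t0 : 0 < t := by linarith
  have h := has (t * Complex.I) (by simp [abs_of_pos t0, ht])
  have e1 : (t * Complex.I : ℂ)^2 = ((-t^2 : ℝ) : ℂ) := by
    rw [mul_pow, Complex.I_sq]; push_cast; ring
  have e2 : (A:ℂ) * (t * Complex.I) * Complex.sin (t * Complex.I * π) = ((-(A * t * Real.sinh (t * π)) : ℝ) : ℂ) := by
    rw [show (t * Complex.I * π : ℂ) = ((t * π : ℝ) : ℂ) * Complex.I by push_cast; ring, Complex.sin_mul_I]
    push_cast
    linear_combination (A * t * Complex.sinh (t * π)) * Complex.I_mul_I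
  rw [e1, hf, e2, ← Complex.ofReal_add, Complex.norm_real] at h
  have e3 : |(t * Complex.I : ℂ).im| = t := by simp [abs_of_pos t0]
  rw [e3] at h
  have h1 := (abs_le.1 h).1
  have h2 : Real.exp (t * π) / 4 ≤ Real.sinh (t * π) := by
    rw [Real.sinh_eq]
    have h5 : (1:ℝ) ≤ t * π := by nlinarith [pi_gt_three]
    have h6 : Real.exp (-(t * π)) ≤ Real.exp (-1) := Real.exp_le_exp.2 (by linarith)
    have h7 : Real.exp 1 ≤ Real.exp (t * π) := Real.exp_le_exp.2 h5
    have h8 : Real.exp (-1) < 0.37 := by linarith [Real.exp_neg_one_lt_d9]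
    have h9 : 2.7 < Real.exp 1 := by linarith [Real.exp_one_gt_d9]
    linarith
  have h3 := mul_le_mul_of_nonneg_left h2 (mul_pos hA t0).le
  have h4 := mul_lt_mul_of_pos_right ht2 (Real.exp_pos (t * π))
  linarith

lemma sin_near (n : ℕ) (t : ℝ) (h : |t - n| ≤ 1/2) : 2 * |t - n| ≤ |Real.sin (t * π)| := by
  have e : |Real.sin (t * π)| = |Real.sin ((t - n) * π)| := by
    rw [show t * π = (t - n) * π + n * π by ring, Real.sin_add_nat_mul_pi, abs_mul]
    simp
  have e2 : |Real.sin ((t - n) * π)| = |Real.sin (|t - n| * π)| := by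
    rcases abs_cases (t - n) with ⟨e, _⟩ | ⟨e, _⟩
    · rw [e]
    · rw [e, neg_mul, Real.sin_neg, abs_neg]
  rw [e, e2]
  have h1 := Real.mul_le_sin (x := |t-n| * π) (by positivity) (by nlinarith [pi_pos])
  have h2 : 2 / π * (|t - n| * π) = 2 * |t-n| := by field_simp
  rw [h2] at h1
  exact h1.trans (le_abs_self _)

theorem core {F : ℂ → ℂ} (hF : Differentiable ℂ F) {f : ℝ → ℝ} (hf : ∀ x : ℝ, F x = f x)
    {ν : ℕ → ℝ} (hm : StrictMono ν) (ν0 : ν 0 = 0)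
    (hz : ∀ z, F z = 0 ↔ ∃ k, z = (ν k : ℂ)) (hs : ∀ z, F z = 0 → deriv F z ≠ 0)
    {A : ℝ} (hA : 0 < A)
    (has : ∃ C s0 : ℝ, 0 < C ∧ 1 ≤ s0 ∧ ∀ s : ℂ, s0 ≤ ‖s‖ → 
        ‖F (s^2) + (A : ℂ) * s * Complex.sin (s * π)‖ ≤ C * Real.exp (|s.im| * π)) :
    Multipliable (fun k : ℕ => ν (k+1) / ((k:ℝ)+1)^2) ∧ 
    HasDerivAt f (-π * A * ∏' k : ℕ, ν (k+1) / ((k:ℝ)+1)^2) 0 := by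
  obtain ⟨C, s0, hC, hs0, H⟩ := id has
  have hfre : ∀ x : ℝ, f x = (F x).re := fun x => by rw [hf]; simp
  have cf : Continuous f := by
    have : f = fun x : ℝ => (F x).re := funext hfre
    rw [this]
    exact Complex.continuous_re.comp (hF.continuous.comp Complex.continuous_ofReal)
  have fz : ∀ x : ℝ, f x = 0 ↔ ∃ k, x = ν k := by
    intro x
    have := hz x
    rw [hf] at this
    exact_mod_cast this
  have νpos : ∀ k, 0 < ν (k+1) := fun k => by rw [← ν0]; exact hm (Nat.succ_pos k)
  have f0 : f 0 = 0 := (fz 0).2 ⟨0, ν0.symm⟩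
  -- zeros
  obtain ⟨n0, hn0⟩ := exists_nat_ge (max s0 (C / A + 1))
  have hn1 : s0 ≤ n0 := (le_max_left _ _).trans hn0
  have hn2 : C / A + 1 ≤ n0 := (le_max_right _ _).trans hn0
  have hn3 : ∀ t : ℝ, (n0:ℝ) ≤ t → C < A * t := by
    intro t ht
    have : C / A < t := by linarith
    rw [div_lt_iff₀ hA] at this; linarith
  have hzero : ∀ N : ℕ, n0 ≤ N → ∃ k, (N+1/2:ℝ)^2 < ν k ∧ ν k < (((N+1 : ℕ):ℝ)+1/2)^2 := by
    intro N hN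
    have hN' : (n0:ℝ) ≤ N := by exact_mod_cast hN
    have a1 := abs_le.1 (real_asymp hf hs0 H (N+1/2) (by linarith))
    have a2 := abs_le.1 (real_asymp hf hs0 H (((N+1:ℕ):ℝ)+1/2) (by push_cast; linarith))
    rw [sin_half] at a1 a2
    have b1 := hn3 (N+1/2) (by linarith)
    have b2 := hn3 (((N+1:ℕ):ℝ)+1/2) (by push_cast; linarith)
    have hlt : ((N:ℝ)+1/2)^2 < (((N+1 : ℕ):ℝ)+1/2)^2 := by
      apply pow_lt_pow_left₀ _ (by positivity) two_ne_zero
      push_cast; linarith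
    have hneg : f (((N:ℝ)+1/2)^2) * f ((((N+1 : ℕ):ℝ)+1/2)^2) < 0 := by
      rw [pow_succ (-1 : ℝ) N] at a2
      rcases neg_one_pow_eq_or ℝ N with e | e
      · rw [e] at a1 a2
        apply mul_neg_of_neg_of_pos <;> linarith [a1.1, a1.2, a2.1, a2.2]
      · rw [e] at a1 a2
        apply mul_neg_of_pos_of_neg <;> linarith [a1.1, a1.2, a2.1, a2.2]
    obtain ⟨x, hx, ex⟩ := ivt_zero cf hlt hneg
    obtain ⟨k, rfl⟩ := (fz x).1 ex
    exact ⟨k, hx⟩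
  have hunb : ∀ N : ℕ, ∃ k, (N+1/2:ℝ)^2 < ν k := by
    intro N
    obtain ⟨k, h1, _⟩ := hzero (max n0 N) (le_max_left _ _)
    refine ⟨k, lt_of_le_of_lt ?_ h1⟩
    have : (N:ℝ) ≤ (max n0 N : ℕ) := by exact_mod_cast le_max_right _ _
    gcongr
  have hmex : ∀ N : ℕ, ∃ m : ℕ, ∀ k, ν k ≤ (N+1/2:ℝ)^2 ↔ k ≤ m := by
    intro N
    classical
    have hpos : Nat.find (hunb N) ≠ 0 := by
      intro h
      have := Nat.find_spec (hunb N)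
      rw [h, ν0] at this
      have : (0:ℝ) < (N+1/2)^2 := by positivity
      linarith
    refine ⟨Nat.find (hunb N) - 1, fun k => ?_⟩
    constructor
    · intro h
      by_contra hk
      have h1 : Nat.find (hunb N) ≤ k := by omega
      have h2 := Nat.find_spec (hunb N)
      have := hm.monotone h1
      linarith
    · intro h
      have := Nat.find_min (hunb N) (m := k) (by omega)
      exact not_lt.1 this
  choose m hc using hmex
  have JL := J_limit hF hm ν0 hz hs hA has m hc
  obtain ⟨⟨N1, hN1⟩, SL⟩ := counting hm ν0 m hc n0 (fun N hN => by
    obtain ⟨k, h1, h2⟩ := hzero N hN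
    exact ⟨k, h1, h2.le⟩) _ JL
  -- closeness
  have hclose : ∀ k : ℕ, N1 ≤ k → n0 + 1 ≤ k → |ν (k+1) - ((k:ℝ)+1)^2| ≤ 2 * C / A := by
    intro k hk hk2
    have h1 : ν (k+1) ≤ (((k+1:ℕ):ℝ)+1/2)^2 := by rw [hc, hN1 (k+1) (by omega)]
    have h2 : ¬ ν (k+1) ≤ ((k:ℝ)+1/2)^2 := by rw [hc, hN1 k hk]; omega
    push Not at h2
    have kn : (n0:ℝ) + 1 ≤ k := by exact_mod_cast hk2
    set t := Real.sqrt (ν (k+1)) with ht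
    have tsq : t^2 = ν (k+1) := Real.sq_sqrt (νpos k).le
    have t0 : 0 ≤ t := Real.sqrt_nonneg _
    have k0 : (0:ℝ) ≤ k := by positivity
    have u1 : t ≤ k + 1 + 1/2 := by
      apply le_of_sq_le_sq _ (by positivity)
      rw [tsq]; push_cast at h1; exact h1
    have u2 : (k:ℝ) + 1/2 < t := by
      apply lt_of_pow_lt_pow_left₀ 2 t0
      rw [tsq]; exact h2
    have hnear := sin_near (k+1) t (by push_cast; rw [abs_le]; constructor <;> linarith)
    have hft : f (t^2) = 0 := by rw [tsq]; exact (fz _).2 ⟨k+1, rfl⟩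
    have ha := real_asymp hf hs0 H t (by linarith)
    have tpos : 0 < t := by linarith
    rw [hft, zero_add, abs_mul, abs_of_pos (mul_pos hA tpos)] at ha
    push_cast at hnear
    have e : ν (k+1) - ((k:ℝ)+1)^2 = (t - (k+1)) * (t + (k+1)) := by rw [← tsq]; ring
    rw [e, abs_mul, abs_of_pos (show 0 < t + ((k:ℝ)+1) by linarith), le_div_iff₀ hA]
    have h3 : t + ((k:ℝ)+1) ≤ 4 * t := by linarith
    have h4 := mul_le_mul_of_nonneg_left hnear (mul_pos hA tpos).le
    calc |t - (k+1)| * (t + (k+1)) * A ≤ |t - (k+1)| * (4 * t) * A := by gcongr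
      _ ≤ 2 * C := by linarith
  have hsum : Summable fun k : ℕ => ν (k+1) / ((k:ℝ)+1)^2 - 1 := by
    have hs2 : Summable fun k : ℕ => (2 * C / A) * (1 / ((k:ℝ)+1)^2) := by
      apply Summable.mul_left
      have := (summable_nat_add_iff 1).2 (Real.summable_one_div_nat_pow.2 (by norm_num : 1 < 2))
      simpa using this
    apply Summable.of_norm_bounded_eventually_nat hs2
    filter_upwards [Filter.eventually_ge_atTop N1, Filter.eventually_ge_atTop (n0+1)] with k h1 h2
    have h3 := hclose k h1 h2
    have e : ν (k+1) / ((k:ℝ)+1)^2 - 1 = (ν (k+1) - ((k:ℝ)+1)^2) * (1 / ((k:ℝ)+1)^2) := by field_simp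
    rw [e, norm_mul, Real.norm_of_nonneg (show (0:ℝ) ≤ 1 / ((k:ℝ)+1)^2 by positivity)]
    gcongr
    exact h3
  have hmult : Multipliable (fun k : ℕ => ν (k+1) / ((k:ℝ)+1)^2) := by
    have := Real.multipliable_one_add_of_summable hsum
    simpa using this
  refine ⟨hmult, ?_⟩
  have d0 : deriv F 0 ≠ 0 := hs 0 ((hz 0).2 ⟨0, by simp [ν0]⟩)
  have dn : 0 < ‖deriv F 0‖ := norm_pos_iff.2 d0
  have hprod : ∏' k : ℕ, ν (k+1) / ((k:ℝ)+1)^2 = ‖deriv F 0‖ / (A * π) := by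
    have t1 := hmult.hasProd.tendsto_prod_nat
    have t2 := (Real.continuous_exp.tendsto _).comp SL.neg
    refine tendsto_nhds_unique t1 ?_
    have e : Real.exp (-(Real.log A + Real.log π - Real.log ‖deriv F 0‖)) = ‖deriv F 0‖ / (A * π) := by
      rw [← Real.log_mul hA.ne' pi_ne_zero, neg_sub, Real.exp_sub, Real.exp_log dn, 
        Real.exp_log (mul_pos hA pi_pos)]
    rw [← e]
    refine t2.congr fun N => ?_
    simp only [Function.comp]
    rw [← Finset.sum_neg_distrib, Real.exp_sum]
    apply Finset.prod_congr rfl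
    intro k _
    have : 0 < ((k:ℝ)+1)^2 / ν (k+1) := div_pos (by positivity) (νpos k)
    rw [Real.exp_neg, Real.exp_log this, inv_div]
  -- sign
  have hpos : ∀ x : ℝ, x < 0 → 0 < f x := by
    intro x hx
    have fne : ∀ y : ℝ, y < 0 → f y ≠ 0 := by
      intro y hy h
      obtain ⟨k, rfl⟩ := (fz y).1 h
      have : ν 0 ≤ ν k := hm.monotone (Nat.zero_le k)
      linarith
    by_contra hcon
    have hlt : f x < 0 := lt_of_le_of_ne (not_lt.1 hcon) (fne x hx)
    set t := max (max s0 (4 * C / A + 1)) (-x + 1) with ht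
    have t1 : s0 ≤ t := (le_max_left _ _).trans (le_max_left _ _)
    have t2 : 4 * C / A + 1 ≤ t := (le_max_right _ _).trans (le_max_left _ _)
    have t3 : -x + 1 ≤ t := le_max_right _ _
    have t4 : 4 * C < A * t := by
      have : 4 * C / A < t := by linarith
      rw [div_lt_iff₀ hA] at this; linarith
    have hp := neg_asymp hf hA hC hs0 H t t1 t4
    obtain ⟨y, hy, ey⟩ := ivt_zero cf (a := -t^2) (b := x) (by nlinarith) (mul_neg_of_pos_of_neg hp hlt)
    exact fne y (hy.2.trans hx) ey
  have D1 : HasDerivAt f (deriv F 0).re 0 := by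
    have : f = fun x : ℝ => (F x).re := funext hfre
    rw [this]
    have h := (hF 0).hasDerivAt
    rw [← Complex.ofReal_zero] at h
    simpa using h.real_of_complex
  have D2 : deriv F 0 = ((deriv F 0).re : ℂ) := by
    have h := (hF 0).hasDerivAt
    rw [← Complex.ofReal_zero] at h
    have h1 := h.comp_ofReal
    simp_rw [hf] at h1
    have := h1.unique D1.ofReal_comp
    simpa using this
  have D3 : (deriv F 0).re ≤ 0 := by
    have h := hasDerivAt_iff_tendsto_slope.1 D1
    have h2 : Filter.Tendsto (slope f 0) (nhdsWithin 0 (Iio 0)) (nhds (deriv F 0).re) :=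
      h.mono_left (nhdsWithin_mono _ (fun x hx => ne_of_lt hx))
    refine le_of_tendsto h2 ?_
    filter_upwards [self_mem_nhdsWithin] with x hx
    rw [slope_def_field, f0, sub_zero, sub_zero]
    exact div_nonpos_of_nonneg_of_nonpos (hpos x hx).le (le_of_lt hx)
  have D4 : ‖deriv F 0‖ = -(deriv F 0).re := by
    have := congrArg norm D2
    rw [Complex.norm_real, Real.norm_of_nonpos D3] at this
    exact this
  rw [hprod, D4]
  convert D1 using 1
  field_simp

theorem statement10 (q : ℝ → ℝ) (hq : IntegrableOn q (Set.Icc (0 : ℝ) π))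
    (α β : ℝ) (hα : α ∈ Set.Ioo (0 : ℝ) π) (hβ : β ∈ Set.Ioo (0 : ℝ) π)
    (μ : ℕ → ℝ) (hmono : StrictMono μ)
    (henum : ∀ lam : ℝ, IsEigenvalue q α β lam ↔ ∃ n : ℕ, μ n = lam)
    (φ φ' : ℝ → ℝ → ℝ)
    (hsol : ∀ lam : ℝ, IsSol q lam (φ lam) (φ' lam))
    (h0 : ∀ lam : ℝ, φ lam 0 = Real.sin α)
    (h0' : ∀ lam : ℝ, φ' lam 0 = -Real.cos α)
    (hdiff : DifferentiableAt ℝ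
      (fun lam => φ lam π * Real.cos β + φ' lam π * Real.sin β) (μ 0)) :
    Multipliable (fun k : ℕ => (μ (k + 1) - μ 0) / ((k : ℝ) + 1) ^ 2) ∧
      deriv (fun lam => φ lam π * Real.cos β + φ' lam π * Real.sin β) (μ 0)
        = -π * Real.sin α * Real.sin β
            * ∏' k : ℕ, (μ (k + 1) - μ 0) / ((k : ℝ) + 1) ^ 2 := by
  have hqi : IntervalIntegrable q volume 0 π := by
    rw [intervalIntegrable_iff_integrableOn_Icc_of_le pi_pos.le]; exact hq
  obtain ⟨F, hF, hFr, hFz, hFs, hFe, hFa⟩ := char_fun hqi (μ 0) hα hβ φ φ' hsol h0 h0'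
  have sα : 0 < Real.sin α := Real.sin_pos_of_mem_Ioo hα
  have sβ : 0 < Real.sin β := Real.sin_pos_of_mem_Ioo hβ
  set Φ : ℝ → ℝ := fun lam => φ lam π * Real.cos β + φ' lam π * Real.sin β with hΦ
  have hf : ∀ x : ℝ, F x = ((fun x => Φ (x + μ 0)) x : ℝ) := by
    intro x
    have := hFr (x + μ 0)
    rw [add_sub_cancel_right] at this
    exact this
  obtain ⟨M, D⟩ := core hF hf (ν := fun k => μ k - μ 0) (fun i j hij => by
      have := hmono hij
      simp only; linarith) (by simp) (by
      intro z
      constructor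
      · intro h
        obtain ⟨x, rfl⟩ := hFz z h
        have h1 := hFe (x + μ 0)
        rw [add_sub_cancel_right] at h1
        obtain ⟨n, hn⟩ := (henum _).1 (h1.1 h)
        exact ⟨n, by rw [hn]; simp⟩
      · rintro ⟨k, rfl⟩
        exact (hFe (μ k)).2 ((henum _).2 ⟨k, rfl⟩)) hFs (mul_pos sα sβ) hFa
  refine ⟨M, ?_⟩
  have D2 : HasDerivAt Φ (-π * (Real.sin α * Real.sin β) * ∏' k : ℕ, (μ (k+1) - μ 0) / ((k:ℝ)+1)^2) (μ 0) := by
    have h1 : HasDerivAt (fun x : ℝ => x - μ 0) 1 (μ 0) := (hasDerivAt_id _).sub_const _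
    have h2 := HasDerivAt.comp (μ 0) (h := fun x : ℝ => x - μ 0) (by simpa using! D) h1
    simpa [Function.comp_def] using h2
  rw [D2.deriv]; ring
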